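/- There exists a constant C depending only on T, q, C₀ and on the initial data ρ₀,u₀,w₀,b₀,θ₀ — specifically on upper bounds for their H²((0,1))-norms, an upper bound for ∫₀¹ ρ₀(|ln ρ₀| + |ln θ₀|) dx, and a positive lower bound for ∫₀¹ ρ₀ dx — but not on the pointwise lower bounds of ρ₀ and θ₀, such that every smooth solution (ρ,u,w,b,θ) of the planar compressible MHD system on Q_T satisfies, for every t ∈ [0,T]: ‖u_{xx}(·,t)‖_{L²(0,1)} ≤ C (1 + ‖√ρ u_t(·,t)‖_{L²(0,1)} + ‖u_x(·,t)‖²_{L²(0,1)} + ‖κ(θ)θ_x(·,t)‖_{L²(0,1)} + ‖ρ_x(·,t)‖_{L²(0,1)} · sup_{x∈[0,1]} θ(x,t)). -/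

import Mathlib

open Real MeasureTheory Set

noncomputable section

/-- Partial derivative in the first (spatial) variable of `f : ℝ → ℝ → ℝ`, `f x t`. -/
def pdx (f : ℝ → ℝ → ℝ) : ℝ → ℝ → ℝ := fun x t => deriv (fun y => f y t) x

/-- Partial derivative in the second (time) variable. -/
def pdt (f : ℝ → ℝ → ℝ) : ℝ → ℝ → ℝ := fun x t => deriv (fun s => f x s) t

/-- The `L²(0,1)` norm of a function. -/
def L2norm (f : ℝ → ℝ) : ℝ := Real.sqrt (∫ x in (0:ℝ)..1, (f x) ^ 2)

/-- The `H²(0,1)` norm of a (smooth) function. -/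
def H2norm (f : ℝ → ℝ) : ℝ :=
  Real.sqrt (∫ x in (0:ℝ)..1, (f x) ^ 2 + (deriv f x) ^ 2 + (deriv (deriv f) x) ^ 2)

/-- A smooth solution of the planar compressible MHD system (all physical constants
normalized to `1`, perfect-gas pressure `P = ρθ`, heat conductivity `κ`) on
`Q_T = [0,1] × [0,T]`:  `ρ, u, θ` are scalar fields, `w, b` are `ℝ²`-valued fields
(given by their two components), everything is smooth, `ρ > 0` and `θ > 0` on `Q_T`,
the five PDEs hold on `Q_T`, and the boundary conditions
`u = 0`, `w = 0`, `b = 0`, `θ_x = 0` hold at `x = 0` and `x = 1`. -/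
structure MHDSol (T : ℝ) (κ : ℝ → ℝ) where
  ρ : ℝ → ℝ → ℝ
  u : ℝ → ℝ → ℝ
  θ : ℝ → ℝ → ℝ
  w : Fin 2 → ℝ → ℝ → ℝ
  b : Fin 2 → ℝ → ℝ → ℝ
  smooth_ρ : ContDiff ℝ (⊤ : ℕ∞) (Function.uncurry ρ)
  smooth_u : ContDiff ℝ (⊤ : ℕ∞) (Function.uncurry u)
  smooth_θ : ContDiff ℝ (⊤ : ℕ∞) (Function.uncurry θ)
  smooth_w : ∀ i, ContDiff ℝ (⊤ : ℕ∞) (Function.uncurry (w i))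
  smooth_b : ∀ i, ContDiff ℝ (⊤ : ℕ∞) (Function.uncurry (b i))
  ρ_pos : ∀ x ∈ Set.Icc (0:ℝ) 1, ∀ t ∈ Set.Icc (0:ℝ) T, 0 < ρ x t
  θ_pos : ∀ x ∈ Set.Icc (0:ℝ) 1, ∀ t ∈ Set.Icc (0:ℝ) T, 0 < θ x t
  eq_mass : ∀ x ∈ Set.Icc (0:ℝ) 1, ∀ t ∈ Set.Icc (0:ℝ) T,
    pdt ρ x t + pdx (fun x t => ρ x t * u x t) x t = 0
  eq_mom : ∀ x ∈ Set.Icc (0:ℝ) 1, ∀ t ∈ Set.Icc (0:ℝ) T,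
    pdt (fun x t => ρ x t * u x t) x t
      + pdx (fun x t =>
          ρ x t * (u x t) ^ 2 + ρ x t * θ x t + (∑ i, (b i x t) ^ 2) / 2) x t
      = pdx (pdx u) x t
  eq_w : ∀ i, ∀ x ∈ Set.Icc (0:ℝ) 1, ∀ t ∈ Set.Icc (0:ℝ) T,
    pdt (fun x t => ρ x t * w i x t) x t
      + pdx (fun x t => ρ x t * u x t * w i x t - b i x t) x t
      = pdx (pdx (w i)) x t
  eq_b : ∀ i, ∀ x ∈ Set.Icc (0:ℝ) 1, ∀ t ∈ Set.Icc (0:ℝ) T,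
    pdt (b i) x t + pdx (fun x t => u x t * b i x t - w i x t) x t
      = pdx (pdx (b i)) x t
  eq_θ : ∀ x ∈ Set.Icc (0:ℝ) 1, ∀ t ∈ Set.Icc (0:ℝ) T,
    pdt (fun x t => ρ x t * θ x t) x t
      + pdx (fun x t => ρ x t * u x t * θ x t) x t
      - pdx (fun x t => κ (θ x t) * pdx θ x t) x t
      = (pdx u x t) ^ 2 + (∑ i, (pdx (w i) x t) ^ 2) + (∑ i, (pdx (b i) x t) ^ 2)
        - ρ x t * θ x t * pdx u x t
  bc_u : ∀ t ∈ Set.Icc (0:ℝ) T, u 0 t = 0 ∧ u 1 t = 0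
  bc_w : ∀ i, ∀ t ∈ Set.Icc (0:ℝ) T, w i 0 t = 0 ∧ w i 1 t = 0
  bc_b : ∀ i, ∀ t ∈ Set.Icc (0:ℝ) T, b i 0 t = 0 ∧ b i 1 t = 0
  bc_θ : ∀ t ∈ Set.Icc (0:ℝ) T, pdx θ 0 t = 0 ∧ pdx θ 1 t = 0

/-- The heat conductivity `κ` is `C²` on `[0,∞)` and satisfies
`C₀⁻¹ (1 + s^q) ≤ κ(s) ≤ C₀ (1 + s^q)` there. -/
def KappaHyp (q C₀ : ℝ) (κ : ℝ → ℝ) : Prop :=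
  ContDiffOn ℝ 2 κ (Set.Ici 0) ∧
  (∀ s : ℝ, 0 ≤ s → C₀⁻¹ * (1 + s ^ q) ≤ κ s) ∧
  (∀ s : ℝ, 0 ≤ s → κ s ≤ C₀ * (1 + s ^ q))

/-- Bounds on the initial data: `A` is an upper bound for the `H²(0,1)` norms of
`ρ₀, u₀, w₀, b₀, θ₀`, `B` is an upper bound for `∫₀¹ ρ₀ (|ln ρ₀| + |ln θ₀|) dx`, and
`M` is a (positive) lower bound for the total mass `∫₀¹ ρ₀ dx`. -/
def InitBounds {T : ℝ} {κ : ℝ → ℝ} (sol : MHDSol T κ) (A B M : ℝ) : Prop :=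
  H2norm (fun x => sol.ρ x 0) ≤ A ∧ H2norm (fun x => sol.u x 0) ≤ A ∧
  H2norm (fun x => sol.θ x 0) ≤ A ∧
  (∀ i, H2norm (fun x => sol.w i x 0) ≤ A) ∧
  (∀ i, H2norm (fun x => sol.b i x 0) ≤ A) ∧
  (∫ x in (0:ℝ)..1, sol.ρ x 0 * (|Real.log (sol.ρ x 0)| + |Real.log (sol.θ x 0)|)) ≤ B ∧
  M ≤ ∫ x in (0:ℝ)..1, sol.ρ x 0

/-- `G` is an upper bound for the `L²(0,1)` norms of the compatibility functions
`g₁ = (∂ₓ²u₀ − ∂ₓ(ρ₀θ₀ + |b₀|²/2))/√ρ₀`, `g₂ = (∂ₓ²w₀ − ∂ₓb₀)/√ρ₀`,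
`g₃ = (∂ₓ(κ(θ₀)∂ₓθ₀) + (∂ₓu₀)² + |∂ₓw₀|² + |∂ₓb₀|²)/√ρ₀`. -/
def CompatBounds {T : ℝ} {κ : ℝ → ℝ} (sol : MHDSol T κ) (G : ℝ) : Prop :=
  L2norm (fun x =>
      (pdx (pdx sol.u) x 0
        - pdx (fun x t => sol.ρ x t * sol.θ x t + (∑ i, (sol.b i x t) ^ 2) / 2) x 0)
      / Real.sqrt (sol.ρ x 0)) ≤ G ∧
  (∀ i, L2norm (fun x =>
      (pdx (pdx (sol.w i)) x 0 - pdx (sol.b i) x 0) / Real.sqrt (sol.ρ x 0)) ≤ G) ∧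
  L2norm (fun x =>
      (pdx (fun x t => κ (sol.θ x t) * pdx sol.θ x t) x 0
        + (pdx sol.u x 0) ^ 2 + (∑ i, (pdx (sol.w i) x 0) ^ 2)
        + (∑ i, (pdx (sol.b i) x 0) ^ 2))
      / Real.sqrt (sol.ρ x 0)) ≤ G


/-! ### Basic tools -/

lemma sm_fderiv_x {f : ℝ → ℝ → ℝ} (hf : ContDiff ℝ (⊤ : ℕ∞) (Function.uncurry f)) (x t : ℝ) :
    HasDerivAt (fun y => f y t) (fderiv ℝ (Function.uncurry f) (x, t) (1, 0)) x := by
  have h1 : HasFDerivAt (Function.uncurry f) (fderiv ℝ (Function.uncurry f) (x, t)) (x, t) :=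
    (hf.differentiable (by simp) (x, t)).hasFDerivAt
  have h2 : HasDerivAt (fun y : ℝ => (y, t)) ((1 : ℝ), (0 : ℝ)) x :=
    (hasDerivAt_id x).prodMk (hasDerivAt_const x t)
  exact h1.comp_hasDerivAt x h2

lemma sm_fderiv_t {f : ℝ → ℝ → ℝ} (hf : ContDiff ℝ (⊤ : ℕ∞) (Function.uncurry f)) (x t : ℝ) :
    HasDerivAt (fun s => f x s) (fderiv ℝ (Function.uncurry f) (x, t) (0, 1)) t := by
  have h1 : HasFDerivAt (Function.uncurry f) (fderiv ℝ (Function.uncurry f) (x, t)) (x, t) :=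
    (hf.differentiable (by simp) (x, t)).hasFDerivAt
  have h2 : HasDerivAt (fun s : ℝ => (x, s)) ((0 : ℝ), (1 : ℝ)) t :=
    (hasDerivAt_const t x).prodMk (hasDerivAt_id t)
  exact h1.comp_hasDerivAt t h2

lemma sm_pdx_eq {f : ℝ → ℝ → ℝ} (hf : ContDiff ℝ (⊤ : ℕ∞) (Function.uncurry f)) :
    Function.uncurry (pdx f) = fun p => fderiv ℝ (Function.uncurry f) p (1, 0) := by
  ext ⟨x, t⟩
  exact (sm_fderiv_x hf x t).deriv

lemma sm_pdt_eq {f : ℝ → ℝ → ℝ} (hf : ContDiff ℝ (⊤ : ℕ∞) (Function.uncurry f)) :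
    Function.uncurry (pdt f) = fun p => fderiv ℝ (Function.uncurry f) p (0, 1) := by
  ext ⟨x, t⟩
  exact (sm_fderiv_t hf x t).deriv

lemma sm_pdx {f : ℝ → ℝ → ℝ} (hf : ContDiff ℝ (⊤ : ℕ∞) (Function.uncurry f)) :
    ContDiff ℝ (⊤ : ℕ∞) (Function.uncurry (pdx f)) := by
  rw [sm_pdx_eq hf]
  have h : ContDiff ℝ (⊤ : ℕ∞) (fderiv ℝ (Function.uncurry f)) :=
    hf.fderiv_right (by simp)
  exact h.clm_apply contDiff_const

lemma sm_pdt {f : ℝ → ℝ → ℝ} (hf : ContDiff ℝ (⊤ : ℕ∞) (Function.uncurry f)) :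
    ContDiff ℝ (⊤ : ℕ∞) (Function.uncurry (pdt f)) := by
  rw [sm_pdt_eq hf]
  have h : ContDiff ℝ (⊤ : ℕ∞) (fderiv ℝ (Function.uncurry f)) :=
    hf.fderiv_right (by simp)
  exact h.clm_apply contDiff_const

lemma sm_hx {f : ℝ → ℝ → ℝ} (hf : ContDiff ℝ (⊤ : ℕ∞) (Function.uncurry f)) (x t : ℝ) :
    HasDerivAt (fun y => f y t) (pdx f x t) x := by
  have h := sm_fderiv_x hf x t
  have h2 : pdx f x t = _ := h.deriv
  rw [h2]; exact h

lemma sm_ht {f : ℝ → ℝ → ℝ} (hf : ContDiff ℝ (⊤ : ℕ∞) (Function.uncurry f)) (x t : ℝ) :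
    HasDerivAt (fun s => f x s) (pdt f x t) t := by
  have h := sm_fderiv_t hf x t
  have h2 : pdt f x t = _ := h.deriv
  rw [h2]; exact h

lemma sm_symm {f : ℝ → ℝ → ℝ} (hf : ContDiff ℝ (⊤ : ℕ∞) (Function.uncurry f)) (x t : ℝ) :
    pdt (pdx f) x t = pdx (pdt f) x t := by
  have h : ContDiff ℝ (⊤ : ℕ∞) (fderiv ℝ (Function.uncurry f)) :=
    hf.fderiv_right (by simp)
  have hd : HasFDerivAt (fderiv ℝ (Function.uncurry f))
      (fderiv ℝ (fderiv ℝ (Function.uncurry f)) (x, t)) (x, t) :=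
    (h.differentiable (by simp) (x, t)).hasFDerivAt
  have e1 : pdt (pdx f) x t = fderiv ℝ (fderiv ℝ (Function.uncurry f)) (x, t) (0, 1) (1, 0) := by
    have h1 := sm_pdt_eq (sm_pdx hf)
    have h2 := congrFun h1 (x, t)
    simp only [Function.uncurry_apply_pair] at h2
    rw [h2, sm_pdx_eq hf]
    have h3 := hd.clm_apply (hasFDerivAt_const ((1 : ℝ), (0 : ℝ)) (x, t))
    rw [h3.fderiv]; simp
  have e2 : pdx (pdt f) x t = fderiv ℝ (fderiv ℝ (Function.uncurry f)) (x, t) (1, 0) (0, 1) := by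
    have h1 := sm_pdx_eq (sm_pdt hf)
    have h2 := congrFun h1 (x, t)
    simp only [Function.uncurry_apply_pair] at h2
    rw [h2, sm_pdt_eq hf]
    have h3 := hd.clm_apply (hasFDerivAt_const ((0 : ℝ), (1 : ℝ)) (x, t))
    rw [h3.fderiv]; simp
  rw [e1, e2]
  have hs : IsSymmSndFDerivAt ℝ (Function.uncurry f) (x, t) :=
    hf.contDiffAt.isSymmSndFDerivAt (by simp; exact WithTop.coe_le_coe.2 (le_top : (2 : ℕ∞) ≤ ⊤))
  exact hs _ _

/-- The rectangle balance law. -/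
lemma balance {a t : ℝ} (ha : 0 ≤ a) (ht : 0 ≤ t) (F Ft G S : ℝ → ℝ → ℝ)
    (hF : ∀ x ∈ Icc 0 a, ∀ s ∈ Icc 0 t, HasDerivAt (fun r => F x r) (Ft x s) s)
    (hG : ∀ x ∈ Icc 0 a, ∀ s ∈ Icc 0 t,
      HasDerivAt (fun y => G y s) (S x s - Ft x s) x)
    (cF : ContinuousOn (Function.uncurry Ft) (Icc 0 a ×ˢ Icc 0 t))
    (cS : ContinuousOn (Function.uncurry S) (Icc 0 a ×ˢ Icc 0 t)) :
    ∫ x in (0:ℝ)..a, (F x t - F x 0)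
      = ∫ s in (0:ℝ)..t, ((∫ x in (0:ℝ)..a, S x s) - (G a s - G 0 s)) := by
  have slx : ∀ (H : ℝ → ℝ → ℝ), ContinuousOn (Function.uncurry H) (Icc 0 a ×ˢ Icc 0 t) →
      ∀ x ∈ Icc 0 a, ContinuousOn (fun s => H x s) (Icc 0 t) := by
    intro H hH x hx
    exact hH.comp (f := fun s => (x, s)) (by fun_prop) (fun s hs => ⟨hx, hs⟩)
  have slt : ∀ (H : ℝ → ℝ → ℝ), ContinuousOn (Function.uncurry H) (Icc 0 a ×ˢ Icc 0 t) →
      ∀ s ∈ Icc 0 t, ContinuousOn (fun x => H x s) (Icc 0 a) := by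
    intro H hH s hs
    exact hH.comp (f := fun x => (x, s)) (by fun_prop) (fun x hx => ⟨hx, hs⟩)
  have h1 : ∫ x in (0:ℝ)..a, (F x t - F x 0) = ∫ x in (0:ℝ)..a, ∫ s in (0:ℝ)..t, Ft x s := by
    apply intervalIntegral.integral_congr
    intro x hx
    rw [uIcc_of_le ha] at hx
    simp only
    rw [intervalIntegral.integral_eq_sub_of_hasDerivAt (f := fun r => F x r)]
    · intro s hs
      rw [uIcc_of_le ht] at hs
      exact hF x hx s hs
    · apply ContinuousOn.intervalIntegrable
      rw [uIcc_of_le ht]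
      exact slx Ft cF x hx
  have h2 : ∫ x in (0:ℝ)..a, ∫ s in (0:ℝ)..t, Ft x s
      = ∫ s in (0:ℝ)..t, ∫ x in (0:ℝ)..a, Ft x s := by
    apply intervalIntegral_intervalIntegral_swap
    rw [uIoc_of_le ha, uIoc_of_le ht]
    refine (ContinuousOn.integrableOn_compact ?_ cF).mono_set ?_
    · exact isCompact_Icc.prod isCompact_Icc
    · exact prod_mono Ioc_subset_Icc_self Ioc_subset_Icc_self
  rw [h1, h2]
  apply intervalIntegral.integral_congr
  intro s hs
  rw [uIcc_of_le ht] at hs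
  simp only
  have i1 : IntervalIntegrable (fun x => S x s) volume 0 a := by
    apply ContinuousOn.intervalIntegrable; rw [uIcc_of_le ha]; exact slt S cS s hs
  have i2 : IntervalIntegrable (fun x => Ft x s) volume 0 a := by
    apply ContinuousOn.intervalIntegrable; rw [uIcc_of_le ha]; exact slt Ft cF s hs
  have h3 := intervalIntegral.integral_eq_sub_of_hasDerivAt (f := fun y => G y s)
    (f' := fun x => S x s - Ft x s) (a := 0) (b := a)
    (by intro x hx; rw [uIcc_of_le ha] at hx; exact hG x hx s hs) (i1.sub i2)
  rw [intervalIntegral.integral_sub i1 i2] at h3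
  linarith

/-- Monotonicity of integrals over `[0,1]` for continuous functions. -/
lemma int_mono {f g : ℝ → ℝ} (hf : ContinuousOn f (Icc 0 1)) (hg : ContinuousOn g (Icc 0 1))
    (h : ∀ x ∈ Icc (0:ℝ) 1, f x ≤ g x) :
    ∫ x in (0:ℝ)..1, f x ≤ ∫ x in (0:ℝ)..1, g x := by
  apply intervalIntegral.integral_mono_on (by norm_num)
  · apply ContinuousOn.intervalIntegrable; rwa [uIcc_of_le (by norm_num)]
  · apply ContinuousOn.intervalIntegrable; rwa [uIcc_of_le (by norm_num)]
  · exact h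

lemma int_nonneg {f : ℝ → ℝ} (h : ∀ x ∈ Icc (0:ℝ) 1, 0 ≤ f x) :
    0 ≤ ∫ x in (0:ℝ)..1, f x :=
  intervalIntegral.integral_nonneg (by norm_num) h

lemma ii {f : ℝ → ℝ} (hf : ContinuousOn f (Icc 0 1)) : IntervalIntegrable f volume 0 1 := by
  apply ContinuousOn.intervalIntegrable; rwa [uIcc_of_le (by norm_num)]

lemma cs_aux {f f' : ℝ → ℝ} (hf : ∀ x ∈ Icc (0:ℝ) 1, HasDerivAt f (f' x) x)
    (hc : ContinuousOn f' (Icc 0 1)) {x y : ℝ} (hx : x ∈ Icc (0:ℝ) 1) (hy : y ∈ Icc (0:ℝ) 1)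
    (hxy : y ≤ x) : (f x - f y) ^ 2 ≤ ∫ z in (0:ℝ)..1, (f' z) ^ 2 := by
  have hsub : Icc y x ⊆ Icc (0:ℝ) 1 := Icc_subset_Icc hy.1 hx.2
  have hcc : ContinuousOn f' (Icc y x) := hc.mono hsub
  have i1 : IntervalIntegrable f' volume y x := by
    apply ContinuousOn.intervalIntegrable; rwa [uIcc_of_le hxy]
  have i2 : IntervalIntegrable (fun z => f' z ^ 2) volume y x := by
    apply ContinuousOn.intervalIntegrable; rw [uIcc_of_le hxy]; exact hcc.pow 2
  have h1 : ∫ z in y..x, f' z = f x - f y :=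
    intervalIntegral.integral_eq_sub_of_hasDerivAt
      (by intro z hz; rw [uIcc_of_le hxy] at hz; exact hf z (hsub hz)) i1
  set d := f x - f y with hd
  have h2 : 0 ≤ ∫ z in y..x, (f' z ^ 2 - 2 * d * f' z + d ^ 2) := by
    apply intervalIntegral.integral_nonneg hxy
    intro z _
    nlinarith [sq_nonneg (f' z - d)]
  rw [intervalIntegral.integral_add (i2.sub (i1.const_mul _)) (by simp),
    intervalIntegral.integral_sub i2 (i1.const_mul _),
    intervalIntegral.integral_const_mul, h1, intervalIntegral.integral_const] at h2
  have h3 : ∫ z in y..x, f' z ^ 2 ≤ ∫ z in (0:ℝ)..1, (f' z) ^ 2 := by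
    apply intervalIntegral.integral_mono_interval hy.1 hxy hx.2
    · exact Filter.Eventually.of_forall (fun z => sq_nonneg _)
    · exact ii (hc.pow 2)
  simp only [smul_eq_mul] at h2
  have h4 : x - y ≤ 1 := by linarith [hx.2, hy.1]
  nlinarith [sq_nonneg d]

lemma cs {f f' : ℝ → ℝ} (hf : ∀ x ∈ Icc (0:ℝ) 1, HasDerivAt f (f' x) x)
    (hc : ContinuousOn f' (Icc 0 1)) {x y : ℝ} (hx : x ∈ Icc (0:ℝ) 1) (hy : y ∈ Icc (0:ℝ) 1) :
    (f x - f y) ^ 2 ≤ ∫ z in (0:ℝ)..1, (f' z) ^ 2 := by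
  rcases le_total y x with h | h
  · exact cs_aux hf hc hx hy h
  · have := cs_aux hf hc hy hx h
    calc (f x - f y) ^ 2 = (f y - f x) ^ 2 := by ring
      _ ≤ _ := this

/-- Sup bound from the `H²` norm. -/
lemma sup_H2 {f : ℝ → ℝ} (hf : ContDiff ℝ (⊤ : ℕ∞) f) {A : ℝ} (h : H2norm f ≤ A) :
    (∀ x ∈ Icc (0:ℝ) 1, (f x) ^ 2 ≤ 2 * A ^ 2) ∧ (∫ x in (0:ℝ)..1, (deriv f x) ^ 2) ≤ A ^ 2 := by
  have c0 : Continuous f := hf.continuous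
  have s1 : ContDiff ℝ (⊤ : ℕ∞) (deriv f) := by
    have := (contDiff_infty_iff_deriv (𝕜 := ℝ) (f := f)).1 hf
    exact this.2
  have s2 : ContDiff ℝ (⊤ : ℕ∞) (deriv (deriv f)) := by
    have := (contDiff_infty_iff_deriv (𝕜 := ℝ) (f := deriv f)).1 s1
    exact this.2
  have c1 := s1.continuous
  have c2 := s2.continuous
  set I0 := ∫ x in (0:ℝ)..1, (f x) ^ 2 with hI0
  set I1 := ∫ x in (0:ℝ)..1, (deriv f x) ^ 2 with hI1
  set I2 := ∫ x in (0:ℝ)..1, (deriv (deriv f) x) ^ 2 with hI2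
  have n0 : 0 ≤ I0 := int_nonneg (fun x _ => sq_nonneg _)
  have n1 : 0 ≤ I1 := int_nonneg (fun x _ => sq_nonneg _)
  have n2 : 0 ≤ I2 := int_nonneg (fun x _ => sq_nonneg _)
  have hsum : I0 + I1 + I2 ≤ A ^ 2 := by
    have e : (∫ x in (0:ℝ)..1, (f x) ^ 2 + (deriv f x) ^ 2 + (deriv (deriv f) x) ^ 2)
        = I0 + I1 + I2 := by
      rw [intervalIntegral.integral_add, intervalIntegral.integral_add]
      all_goals apply Continuous.intervalIntegrable; fun_prop
    unfold H2norm at h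
    rw [e] at h
    have : I0 + I1 + I2 = (Real.sqrt (I0 + I1 + I2)) ^ 2 := (Real.sq_sqrt (by positivity)).symm
    rw [this]
    gcongr
  refine ⟨?_, by linarith⟩
  intro x hx
  have hy : ∀ y ∈ Icc (0:ℝ) 1, (f x) ^ 2 ≤ 2 * (f y) ^ 2 + 2 * I1 := by
    intro y hy
    have := cs (f := f) (f' := deriv f)
      (fun z _ => (hf.differentiable (by simp) z).hasDerivAt) c1.continuousOn hx hy
    nlinarith [sq_nonneg (f x - 2 * f y)]
  have h5 : ∫ y in (0:ℝ)..1, (f x) ^ 2 ≤ ∫ y in (0:ℝ)..1, (2 * (f y) ^ 2 + 2 * I1) :=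
    int_mono (by fun_prop) (by fun_prop) hy
  rw [intervalIntegral.integral_add (by apply Continuous.intervalIntegrable; fun_prop) (by simp),
    intervalIntegral.integral_const_mul] at h5
  simp at h5
  linarith

lemma hd_sq {f : ℝ → ℝ} {f' x : ℝ} (h : HasDerivAt f f' x) :
    HasDerivAt (fun y => f y ^ 2) (2 * f x * f') x := by
  have := h.mul h
  have e : (fun y => f y ^ 2) = f * f := by funext y; simp [pow_two]
  rw [e]
  exact this.congr_deriv (by ring)

/-- Gronwall-type bound for the derivative of one magnetic component. -/
lemma step_b {T N Y0 : ℝ} (b bx bxx bt bxt u ux wx : ℝ → ℝ → ℝ)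
    (cbx : Continuous (Function.uncurry bx))
    (cbxx : Continuous (Function.uncurry bxx)) (cbt : Continuous (Function.uncurry bt))
    (cbxt : Continuous (Function.uncurry bxt))
    (cux : Continuous (Function.uncurry ux)) (cwx : Continuous (Function.uncurry wx))
    (hb : ∀ x t, HasDerivAt (fun y => b y t) (bx x t) x)
    (hbx : ∀ x t, HasDerivAt (fun y => bx y t) (bxx x t) x)
    (hbxt : ∀ x t, HasDerivAt (fun s => bx x s) (bxt x t) t)
    (hbt : ∀ x t, HasDerivAt (fun y => bt y t) (bxt x t) x)
    (hu : ∀ x t, HasDerivAt (fun y => u y t) (ux x t) x)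
    (pde : ∀ x ∈ Icc (0:ℝ) 1, ∀ t ∈ Icc (0:ℝ) T,
      bt x t + ux x t * b x t + u x t * bx x t - wx x t = bxx x t)
    (b0 : ∀ t ∈ Icc (0:ℝ) T, b 0 t = 0) (u0 : ∀ t ∈ Icc (0:ℝ) T, u 0 t = 0)
    (bt0 : ∀ t ∈ Icc (0:ℝ) T, bt 0 t = 0) (bt1 : ∀ t ∈ Icc (0:ℝ) T, bt 1 t = 0)
    (hN1 : ∀ t ∈ Icc (0:ℝ) T, ∫ s in (0:ℝ)..t, ∫ x in (0:ℝ)..1, ux x s ^ 2 ≤ N)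
    (hN2 : ∀ t ∈ Icc (0:ℝ) T, ∫ s in (0:ℝ)..t, ∫ x in (0:ℝ)..1, wx x s ^ 2 ≤ N)
    (hY0 : ∫ x in (0:ℝ)..1, bx x 0 ^ 2 ≤ Y0) :
    ∀ t ∈ Icc (0:ℝ) T, ∫ x in (0:ℝ)..1, bx x t ^ 2 ≤ exp (3 * N) * (Y0 + 3 / 2 * N) := by
  intro t ht
  set U : ℝ → ℝ := fun s => ∫ x in (0:ℝ)..1, ux x s ^ 2 with hU
  set W : ℝ → ℝ := fun s => ∫ x in (0:ℝ)..1, wx x s ^ 2 with hW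
  have cU : Continuous U := by rw [hU]; fun_prop
  have cW : Continuous W := by rw [hW]; fun_prop
  set a : ℝ → ℝ := fun s => ∫ r in (0:ℝ)..s, U r with ha
  have da : ∀ s, HasDerivAt a (U s) s := fun s => (cU.integral_hasStrictDerivAt 0 s).hasDerivAt
  have ca : Continuous a := continuous_iff_continuousAt.2 fun s => (da s).continuousAt
  set e : ℝ → ℝ := fun s => exp (-3 * a s) with he
  have ce : Continuous e := by rw [he]; fun_prop
  have de : ∀ s, HasDerivAt e (e s * (-3 * U s)) s := fun s => ((da s).const_mul (-3)).exp
  have Upos : ∀ s, 0 ≤ U s := fun s => int_nonneg (fun x _ => sq_nonneg _)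
  have Wpos : ∀ s, 0 ≤ W s := fun s => int_nonneg (fun x _ => sq_nonneg _)
  have epos : ∀ s, 0 < e s := fun s => exp_pos _
  have apos : ∀ s, 0 ≤ s → 0 ≤ a s := fun s hs =>
    intervalIntegral.integral_nonneg hs (fun r _ => Upos r)
  have ele : ∀ s, 0 ≤ s → e s ≤ 1 := by
    intro s hs
    simp only [he]
    rw [exp_le_one_iff]
    nlinarith [apos s hs]
  have key := balance (a := 1) (t := t) zero_le_one ht.1
    (fun x s => e s * bx x s ^ 2)
    (fun x s => e s * (-3 * U s * bx x s ^ 2 + 2 * bx x s * bxt x s))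
    (fun x s => -2 * e s * (bx x s * bt x s))
    (fun x s => e s * (-3 * U s * bx x s ^ 2 - 2 * bxx x s * bt x s))
    (by
      intro x _ s _
      refine ((de s).mul (hd_sq (hbxt x s))).congr_deriv ?_
      ring)
    (by
      intro x _ s _
      refine (((hbx x s).mul (hbt x s)).const_mul (-2 * e s)).congr_deriv ?_
      ring)
    (by apply Continuous.continuousOn; unfold Function.uncurry; fun_prop)
    (by apply Continuous.continuousOn; unfold Function.uncurry; fun_prop)
  have hS : ∀ s ∈ Icc (0:ℝ) t,
      (∫ x in (0:ℝ)..1, e s * (-3 * U s * bx x s ^ 2 - 2 * bxx x s * bt x s))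
      - (-2 * e s * (bx 1 s * bt 1 s) - -2 * e s * (bx 0 s * bt 0 s)) ≤ 3 / 2 * W s := by
    intro s hs
    have hsT : s ∈ Icc (0:ℝ) T := ⟨hs.1, hs.2.trans ht.2⟩
    rw [bt0 s hsT, bt1 s hsT]
    set Y := ∫ x in (0:ℝ)..1, bx x s ^ 2 with hY
    have h1 : ∫ x in (0:ℝ)..1, e s * (-3 * U s * bx x s ^ 2 - 2 * bxx x s * bt x s)
        ≤ ∫ x in (0:ℝ)..1, e s * (-3 * U s * bx x s ^ 2 +
          3 / 2 * (ux x s ^ 2 * Y + U s * bx x s ^ 2 + wx x s ^ 2)) := by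
      apply int_mono
      · fun_prop
      · fun_prop
      intro x hx
      apply mul_le_mul_of_nonneg_left _ (epos s).le
      have hbY : b x s ^ 2 ≤ Y := by
        have := cs (fun z _ => hb z s) (by fun_prop) hx (y := 0) (by simp)
        rw [b0 s hsT, sub_zero] at this
        exact this
      have huU : u x s ^ 2 ≤ U s := by
        have := cs (fun z _ => hu z s) (by fun_prop) hx (y := 0) (by simp)
        rw [u0 s hsT, sub_zero] at this
        exact this
      have hp := pde x hx s hsT
      have e1 : bt x s = bxx x s - (ux x s * b x s + u x s * bx x s - wx x s) := by linarith
      rw [e1]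
      have i1 : (ux x s) ^ 2 * (b x s) ^ 2 ≤ (ux x s) ^ 2 * Y :=
        mul_le_mul_of_nonneg_left hbY (sq_nonneg _)
      have i2 : (u x s) ^ 2 * (bx x s) ^ 2 ≤ U s * (bx x s) ^ 2 :=
        mul_le_mul_of_nonneg_right huU (sq_nonneg _)
      have i1' : (ux x s * b x s) ^ 2 ≤ (ux x s) ^ 2 * Y := by rw [mul_pow]; exact i1
      have i2' : (u x s * bx x s) ^ 2 ≤ U s * (bx x s) ^ 2 := by rw [mul_pow]; exact i2
      have i3 : ∀ B p q r : ℝ, -2 * B * (B - (p + q - r)) ≤ 3 / 2 * (p ^ 2 + q ^ 2 + r ^ 2) := by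
        intro B p q r
        nlinarith [sq_nonneg (2 * B - (p + q - r)), sq_nonneg (p - q), sq_nonneg (p + r),
          sq_nonneg (q + r)]
      have i4 := i3 (bxx x s) (ux x s * b x s) (u x s * bx x s) (wx x s)
      linarith
    have h2 : ∫ x in (0:ℝ)..1, e s * (-3 * U s * bx x s ^ 2 +
          3 / 2 * (ux x s ^ 2 * Y + U s * bx x s ^ 2 + wx x s ^ 2)) =
          e s * (-3 * U s * Y + 3 / 2 * (U s * Y + U s * Y + W s)) := by
      rw [intervalIntegral.integral_const_mul, intervalIntegral.integral_add,
        intervalIntegral.integral_const_mul, intervalIntegral.integral_const_mul,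
        intervalIntegral.integral_add, intervalIntegral.integral_add,
        intervalIntegral.integral_mul_const, intervalIntegral.integral_const_mul]
      all_goals apply Continuous.intervalIntegrable; fun_prop
    rw [h2] at h1
    have h3 := mul_le_mul_of_nonneg_right (ele s hs.1) (Wpos s)
    nlinarith
  have hint : ∫ x in (0:ℝ)..1, (e t * bx x t ^ 2 - e 0 * bx x 0 ^ 2) ≤ 3 / 2 * N := by
    rw [key]
    calc _ ≤ ∫ s in (0:ℝ)..t, 3 / 2 * W s := by
          apply intervalIntegral.integral_mono_on ht.1 _ _ hS
          · apply Continuous.intervalIntegrable; fun_prop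
          · apply Continuous.intervalIntegrable; fun_prop
      _ = 3 / 2 * ∫ s in (0:ℝ)..t, W s := by rw [intervalIntegral.integral_const_mul]
      _ ≤ _ := by have := hN2 t ht; linarith
  have e0 : e 0 = 1 := by simp [he, ha]
  rw [intervalIntegral.integral_sub, intervalIntegral.integral_const_mul,
    intervalIntegral.integral_const_mul, e0] at hint
  rotate_left
  · apply Continuous.intervalIntegrable; fun_prop
  · apply Continuous.intervalIntegrable; fun_prop
  have h5 : e t * ∫ x in (0:ℝ)..1, bx x t ^ 2 ≤ Y0 + 3 / 2 * N := by linarith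
  have h6 : exp (-(3 * N)) ≤ e t := by
    simp only [he]; apply exp_le_exp.2
    have := hN1 t ht
    simp only [ha]
    linarith
  have h7 : 0 ≤ ∫ x in (0:ℝ)..1, bx x t ^ 2 := int_nonneg (fun x _ => sq_nonneg _)
  have h8 : exp (-(3 * N)) * ∫ x in (0:ℝ)..1, bx x t ^ 2 ≤ Y0 + 3 / 2 * N :=
    (mul_le_mul_of_nonneg_right h6 h7).trans h5
  have h9 := mul_le_mul_of_nonneg_left h8 (exp_pos (3 * N)).le
  rw [← mul_assoc, ← exp_add] at h9
  simpa using h9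

/-- A maximum principle. -/
lemma maxp {T c : ℝ} (F : ℝ → ℝ → ℝ)
    (cF : ContinuousOn (Function.uncurry F) (Icc (0:ℝ) 1 ×ˢ Icc (0:ℝ) T))
    (h : ∀ x ∈ Icc (0:ℝ) 1, ∀ t ∈ Ioc (0:ℝ) T,
      (x ∈ Ioo (0:ℝ) 1 → deriv (fun y => F y t) x = 0) →
      ∃ D, HasDerivAt (fun s => F x s) D t ∧ D ≤ 0)
    (h0 : ∀ x ∈ Icc (0:ℝ) 1, F x 0 ≤ c) :
    ∀ x ∈ Icc (0:ℝ) 1, ∀ t ∈ Icc (0:ℝ) T, F x t ≤ c + T := by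
  intro x hx t ht
  have hne : (Icc (0:ℝ) 1 ×ˢ Icc (0:ℝ) T).Nonempty := ⟨(x, t), hx, ht⟩
  obtain ⟨⟨x0, t0⟩, ⟨hx0, ht0⟩, hmax⟩ := (isCompact_Icc.prod isCompact_Icc).exists_isMaxOn hne
    (f := fun p : ℝ × ℝ => F p.1 p.2 - p.2) (by
      apply ContinuousOn.sub cF
      fun_prop)
  simp only at hx0 ht0
  have hm : ∀ y ∈ Icc (0:ℝ) 1, ∀ s ∈ Icc (0:ℝ) T, F y s - s ≤ F x0 t0 - t0 :=
    fun y hy s hs => hmax (show (y, s) ∈ _ from ⟨hy, hs⟩)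
  rcases eq_or_lt_of_le ht0.1 with h00 | hpos
  · have := hm x hx t ht
    rw [← h00] at this
    have h2 := h0 x0 hx0
    linarith [ht.2]
  · exfalso
    obtain ⟨D, hD, hD0⟩ := h x0 hx0 t0 ⟨hpos, ht0.2⟩ (by
      intro hi
      apply IsLocalMax.deriv_eq_zero
      filter_upwards [isOpen_Ioo.mem_nhds hi] with y hy
      have := hm y ⟨hy.1.le, hy.2.le⟩ t0 ht0
      linarith)
    have h1 : HasDerivAt (fun s => F x0 s - s) (D - 1) t0 := hD.sub (hasDerivAt_id t0)
    have h2 : HasDerivWithinAt (fun s => F x0 s - s) (D - 1) (Iio t0) t0 := h1.hasDerivWithinAt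
    rw [hasDerivWithinAt_iff_tendsto_slope' (by simp)] at h2
    have h3 : 0 ≤ D - 1 := by
      apply ge_of_tendsto h2
      filter_upwards [Ioo_mem_nhdsLT hpos] with s hs
      rw [slope_def_field]
      apply div_nonneg_of_nonpos
      · have := hm x0 hx0 s ⟨hs.1.le, hs.2.le.trans ht0.2⟩
        linarith
      · linarith [hs.2]
    linarith

/-- Upper bound for the density. -/
lemma step_rho {T mb E r0 : ℝ} (hT : 0 < T)
    (ρ ρx ρt u ux P mt : ℝ → ℝ → ℝ)
    (cρ : Continuous (Function.uncurry ρ)) (cu : Continuous (Function.uncurry u))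
    (cux : Continuous (Function.uncurry ux)) (cP : Continuous (Function.uncurry P))
    (cmt : Continuous (Function.uncurry mt))
    (hρx : ∀ x t, HasDerivAt (fun y => ρ y t) (ρx x t) x)
    (hρt : ∀ x t, HasDerivAt (fun s => ρ x s) (ρt x t) t)
    (hux : ∀ x t, HasDerivAt (fun y => u y t) (ux x t) x)
    (hmt : ∀ x t, HasDerivAt (fun s => ρ x s * u x s) (mt x t) t)
    (hfl : ∀ x ∈ Icc (0:ℝ) 1, ∀ t ∈ Icc (0:ℝ) T,
      HasDerivAt (fun y => ρ y t * u y t ^ 2 + P y t - ux y t) (- mt x t) x)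
    (mass : ∀ x ∈ Icc (0:ℝ) 1, ∀ t ∈ Icc (0:ℝ) T, ρt x t + ρx x t * u x t + ρ x t * ux x t = 0)
    (ρpos : ∀ x ∈ Icc (0:ℝ) 1, ∀ t ∈ Icc (0:ℝ) T, 0 < ρ x t)
    (Ppos : ∀ x ∈ Icc (0:ℝ) 1, ∀ t ∈ Icc (0:ℝ) T, 0 ≤ P x t)
    (u0 : ∀ t ∈ Icc (0:ℝ) T, u 0 t = 0) (u1 : ∀ t ∈ Icc (0:ℝ) T, u 1 t = 0)
    (hmb : ∀ t ∈ Icc (0:ℝ) T, ∫ x in (0:ℝ)..1, ρ x t ≤ mb)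
    (hE : ∀ t ∈ Icc (0:ℝ) T, ∫ x in (0:ℝ)..1, (ρ x t * u x t ^ 2 + P x t) ≤ 2 * E)
    (hr0 : ∀ x ∈ Icc (0:ℝ) 1, ρ x 0 ≤ r0) :
    ∀ x ∈ Icc (0:ℝ) 1, ∀ t ∈ Icc (0:ℝ) T,
      ρ x t ≤ exp (r0 + (2 * mb + 4 * E) + T * (2 * E) + T) := by
  have z0 : (0:ℝ) ∈ Icc (0:ℝ) T := ⟨le_rfl, hT.le⟩
  set fl : ℝ → ℝ → ℝ := fun x t => ρ x t * u x t ^ 2 + P x t - ux x t with hfld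
  have cfl : Continuous (Function.uncurry fl) := by
    rw [hfld]; unfold Function.uncurry; fun_prop
  set ψ : ℝ → ℝ → ℝ := fun x t => ∫ y in (0:ℝ)..x, ρ y t * u y t with hψ
  set m1 := (mb + 2 * E) / 2 with hm1
  have bψ : ∀ x ∈ Icc (0:ℝ) 1, ∀ t ∈ Icc (0:ℝ) T, |ψ x t| ≤ m1 := by
    intro x hx t ht
    have h1 : |ψ x t| ≤ ∫ y in (0:ℝ)..x, |ρ y t * u y t| := by
      simp only [hψ]
      exact intervalIntegral.abs_integral_le_integral_abs hx.1
    have h2 : ∫ y in (0:ℝ)..x, |ρ y t * u y t| ≤ ∫ y in (0:ℝ)..1, |ρ y t * u y t| := by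
      apply intervalIntegral.integral_mono_interval le_rfl hx.1 hx.2
      · exact Filter.Eventually.of_forall (fun z => abs_nonneg _)
      · apply Continuous.intervalIntegrable; fun_prop
    have h3 : ∫ y in (0:ℝ)..1, |ρ y t * u y t|
        ≤ ∫ y in (0:ℝ)..1, (ρ y t + (ρ y t * u y t ^ 2 + P y t)) / 2 := by
      apply int_mono
      · fun_prop
      · fun_prop
      intro y hy
      rw [abs_mul, abs_of_pos (ρpos y hy t ht)]
      have := Ppos y hy t ht
      have h4 := mul_nonneg (ρpos y hy t ht).le (sq_nonneg (|u y t| - 1))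
      have h5 := sq_abs (u y t)
      have h6 : ρ y t * (|u y t| - 1) ^ 2 = ρ y t * u y t ^ 2 - 2 * (ρ y t * |u y t|) + ρ y t := by
        rw [← h5]; ring
      linarith
    rw [intervalIntegral.integral_div, intervalIntegral.integral_add] at h3
    rotate_left
    · apply Continuous.intervalIntegrable; fun_prop
    · apply Continuous.intervalIntegrable; fun_prop
    have := hmb t ht
    have := hE t ht
    linarith
  set φ : ℝ → ℝ → ℝ := fun x t => ψ x 0 - ∫ s in (0:ℝ)..t, fl x s with hφ
  have φeq : ∀ x ∈ Icc (0:ℝ) 1, ∀ t ∈ Icc (0:ℝ) T,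
      φ x t = ψ x t - ∫ s in (0:ℝ)..t, fl 0 s := by
    intro x hx t ht
    have key := balance (a := x) (t := t) hx.1 ht.1 (fun x s => ρ x s * u x s) mt fl
      (fun _ _ => 0) (fun y _ s _ => hmt y s)
      (fun y hy s hs => by
        have := hfl y ⟨hy.1, hy.2.trans hx.2⟩ s ⟨hs.1, hs.2.trans ht.2⟩
        simpa using this)
      cmt.continuousOn (by apply Continuous.continuousOn; unfold Function.uncurry; fun_prop)
    rw [intervalIntegral.integral_sub] at key
    rotate_left
    · apply Continuous.intervalIntegrable; fun_prop
    · apply Continuous.intervalIntegrable; fun_prop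
    simp only [intervalIntegral.integral_zero, zero_sub, neg_sub] at key
    rw [intervalIntegral.integral_sub] at key
    rotate_left
    · apply Continuous.intervalIntegrable; fun_prop
    · apply Continuous.intervalIntegrable; fun_prop
    simp only [hφ, hψ]
    linarith
  have cφ : Continuous (Function.uncurry φ) := by
    have c1 : Continuous fun p : ℝ × ℝ => ∫ y in (0:ℝ)..p.1, ρ y 0 * u y 0 :=
      intervalIntegral.continuous_parametric_intervalIntegral_of_continuous
        (f := fun _ y => ρ y 0 * u y 0) (by unfold Function.uncurry; fun_prop) continuous_fst
    have c2 : Continuous fun p : ℝ × ℝ => ∫ s in (0:ℝ)..p.2, fl p.1 s :=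
      intervalIntegral.continuous_parametric_intervalIntegral_of_continuous
        (f := fun (p : ℝ × ℝ) s => fl p.1 s) (by unfold Function.uncurry; fun_prop) continuous_snd
    exact c1.sub c2
  have lowφ : ∀ x ∈ Icc (0:ℝ) 1, ∀ t ∈ Icc (0:ℝ) T, -(3 * m1 + T * (2 * E)) ≤ φ x t := by
    intro x hx t ht
    set k := ∫ s in (0:ℝ)..t, fl 0 s with hk
    have hEn : 0 ≤ 2 * E := le_trans (int_nonneg (fun y hy => by
      have := (ρpos y hy t ht).le
      have := Ppos y hy t ht
      positivity)) (hE t ht)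
    have h1 : ∫ y in (0:ℝ)..1, (ψ y 0 - φ y t) ≤ T * (2 * E) := by
      have e1 : ∫ y in (0:ℝ)..1, (ψ y 0 - φ y t) = ∫ y in (0:ℝ)..1, ∫ s in (0:ℝ)..t, fl y s := by
        apply intervalIntegral.integral_congr
        intro y _
        simp only [hφ]; ring
      rw [e1, intervalIntegral_intervalIntegral_swap]
      rotate_left
      · refine (ContinuousOn.integrableOn_compact ?_ cfl.continuousOn).mono_set
          (prod_mono uIoc_subset_uIcc uIoc_subset_uIcc)
        exact isCompact_uIcc.prod isCompact_uIcc
      calc _ ≤ ∫ s in (0:ℝ)..t, 2 * E := by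
            apply intervalIntegral.integral_mono_on ht.1
            · apply Continuous.intervalIntegrable; fun_prop
            · simp
            intro s hs
            have hsT : s ∈ Icc (0:ℝ) T := ⟨hs.1, hs.2.trans ht.2⟩
            simp only [hfld]
            rw [intervalIntegral.integral_sub]
            rotate_left
            · apply Continuous.intervalIntegrable; fun_prop
            · apply Continuous.intervalIntegrable; fun_prop
            have e2 : ∫ y in (0:ℝ)..1, ux y s = u 1 s - u 0 s :=
              intervalIntegral.integral_eq_sub_of_hasDerivAt (f := fun y => u y s)
                (fun y _ => hux y s) (by apply Continuous.intervalIntegrable; fun_prop)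
            rw [e2, u0 s hsT, u1 s hsT]
            have := hE s hsT
            linarith
        _ = t * (2 * E) := by simp; ring
        _ ≤ _ := mul_le_mul_of_nonneg_right ht.2 hEn
    have h2 : ∫ y in (0:ℝ)..1, (k - 2 * m1) ≤ ∫ y in (0:ℝ)..1, (ψ y 0 - φ y t) := by
      apply int_mono
      · fun_prop
      · have : (fun y => ψ y 0 - φ y t) = fun y => ∫ s in (0:ℝ)..t, fl y s := by
          funext y; simp only [hφ]; ring
        rw [this]
        apply Continuous.continuousOn
        fun_prop
      intro y hy
      rw [φeq y hy t ht]
      have a1 := (abs_le.1 (bψ y hy t ht)).2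
      have a2 := (abs_le.1 (bψ y hy 0 z0)).1
      linarith
    simp at h2
    rw [φeq x hx t ht]
    have a1 := (abs_le.1 (bψ x hx t ht)).1
    linarith
  have hF := maxp (T := T) (c := r0 + m1) (fun x t => log (ρ x t) + φ x t)
    (by
      apply ContinuousOn.add
      · apply ContinuousOn.log cρ.continuousOn
        rintro ⟨x, t⟩ ⟨hx, ht⟩
        exact (ρpos x hx t ht).ne'
      · exact cφ.continuousOn)
    (by
      intro x hx t ht hd
      have htT : t ∈ Icc (0:ℝ) T := ⟨ht.1.le, ht.2⟩
      have hp := ρpos x hx t htT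
      have hm := mass x hx t htT
      have hP := Ppos x hx t htT
      refine ⟨ρt x t / ρ x t - fl x t, ?_, ?_⟩
      · have d1 := (hρt x t).log hp.ne'
        have cc : Continuous (fun s => fl x s) := by fun_prop
        have d2 : HasDerivAt (fun s => φ x s) (0 - fl x t) t :=
          (hasDerivAt_const t (ψ x 0)).sub (cc.integral_hasStrictDerivAt 0 t).hasDerivAt
        exact (d1.add d2).congr_deriv (by ring)
      · have e1 : ρt x t / ρ x t = - (ρx x t / ρ x t) * u x t - ux x t := by
          field_simp; linarith
        rw [e1]
        simp only [hfld]
        have e2 : u x t * (ρx x t / ρ x t + ρ x t * u x t) = 0 := by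
          rcases eq_or_lt_of_le hx.1 with h0 | h0
          · rw [← h0, u0 t htT]; ring
          rcases eq_or_lt_of_le hx.2 with h1 | h1
          · rw [h1, u1 t htT]; ring
          have hxi : x ∈ Ioo (0:ℝ) 1 := ⟨h0, h1⟩
          have d1 := (hρx x t).log hp.ne'
          have d2 : HasDerivAt (fun y => ψ y t - ∫ s in (0:ℝ)..t, fl 0 s) (ρ x t * u x t) x := by
            have cc : Continuous (fun y => ρ y t * u y t) := by fun_prop
            exact (cc.integral_hasStrictDerivAt 0 x).hasDerivAt.sub_const _
          have d3 : HasDerivAt (fun y => φ y t) (ρ x t * u x t) x := by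
            apply d2.congr_of_eventuallyEq
            filter_upwards [isOpen_Ioo.mem_nhds hxi] with y hy
            exact φeq y ⟨hy.1.le, hy.2.le⟩ t htT
          have d4 := (d1.add d3).deriv
          have d5 : ρx x t / ρ x t + ρ x t * u x t = 0 := by
            rw [← d4]; exact hd hxi
          rw [d5]; ring
        nlinarith)
    (by
      intro x hx
      have h1 : log (ρ x 0) ≤ r0 := by
        have := Real.log_le_sub_one_of_pos (ρpos x hx 0 z0)
        have := hr0 x hx
        linarith
      have h2 : φ x 0 ≤ m1 := by
        rw [φeq x hx 0 z0]
        simp only [intervalIntegral.integral_same, sub_zero]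
        exact (abs_le.1 (bψ x hx 0 z0)).2
      linarith)
  intro x hx t ht
  have h1 := hF x hx t ht
  have h2 := lowφ x hx t ht
  have h3 : log (ρ x t) ≤ r0 + (2 * mb + 4 * E) + T * (2 * E) + T := by
    have : 4 * m1 = 2 * mb + 4 * E := by rw [hm1]; ring
    linarith
  rw [← exp_log (ρpos x hx t ht)]
  exact exp_le_exp.2 h3

lemma par_cont {t : ℝ} (ht : 0 ≤ t) (S : ℝ → ℝ → ℝ)
    (cS : ContinuousOn (Function.uncurry S) (Icc 0 1 ×ˢ Icc 0 t)) :
    ContinuousOn (fun s => ∫ x in (0:ℝ)..1, S x s) (Icc 0 t) := by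
  have mem : ∀ a : ℝ, 0 ≤ a → ∀ x : ℝ, max 0 (min x a) ∈ Icc (0:ℝ) a := fun a ha x =>
    ⟨le_max_left _ _, max_le ha (min_le_right _ _)⟩
  have fix : ∀ a : ℝ, ∀ x ∈ Icc (0:ℝ) a, max 0 (min x a) = x := fun a x hx => by
    rw [min_eq_left hx.2, max_eq_right hx.1]
  have c : Continuous (Function.uncurry fun s x => S (max 0 (min x 1)) (max 0 (min s t))) := by
    have := cS.comp_continuous (f := fun p : ℝ × ℝ => (max 0 (min p.2 1), max 0 (min p.1 t)))
      (by fun_prop) (fun p => ⟨mem 1 zero_le_one _, mem t ht _⟩)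
    exact this
  have c2 := intervalIntegral.continuous_parametric_intervalIntegral_of_continuous'
    (μ := volume) c 0 1
  refine c2.continuousOn.congr ?_
  intro s hs
  apply intervalIntegral.integral_congr
  intro x hx
  rw [uIcc_of_le zero_le_one] at hx
  simp only
  rw [fix 1 x hx, fix t s hs]

/-- Pointwise bound of the temperature. -/
lemma theta_bound {E M : ℝ} (hM : 0 < M) (ρ θ θx : ℝ → ℝ) (cρ : Continuous ρ)
    (cθx : Continuous θx) (hθ : ∀ x, HasDerivAt θ (θx x) x)
    (ρpos : ∀ x ∈ Icc (0:ℝ) 1, 0 < ρ x) (θpos : ∀ x ∈ Icc (0:ℝ) 1, 0 < θ x)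
    (hm : M ≤ ∫ x in (0:ℝ)..1, ρ x) (hE : ∫ x in (0:ℝ)..1, ρ x * θ x ≤ E) :
    ∀ x ∈ Icc (0:ℝ) 1, θ x ≤ 2 * E / M + (∫ z in (0:ℝ)..1, θx z ^ 2 / θ z) / 2 := by
  intro x hx
  have cθ : Continuous θ := continuous_iff_continuousAt.2 fun s => (hθ s).continuousAt
  obtain ⟨y, hy, hmin⟩ := isCompact_Icc.exists_isMinOn (f := θ) (s := Icc (0:ℝ) 1)
    ⟨0, by simp⟩ cθ.continuousOn
  have hy1 : θ y ≤ E / M := by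
    rw [le_div_iff₀ hM]
    have h1 : ∫ z in (0:ℝ)..1, θ y * ρ z ≤ ∫ z in (0:ℝ)..1, ρ z * θ z := by
      apply int_mono
      · fun_prop
      · fun_prop
      intro z hz
      rw [mul_comm (ρ z)]
      exact mul_le_mul_of_nonneg_right (hmin hz) (ρpos z hz).le
    rw [intervalIntegral.integral_const_mul] at h1
    have := mul_le_mul_of_nonneg_left hm (θpos y hy).le
    linarith
  have hc := cs (f := fun z => √(θ z)) (f' := fun z => θx z / (2 * √(θ z)))
    (fun z hz => (hθ z).sqrt (θpos z hz).ne')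
    (by
      apply ContinuousOn.div (by fun_prop) (by fun_prop)
      intro z hz
      have := Real.sqrt_pos.2 (θpos z hz)
      positivity) hx hy
  have he : ∫ z in (0:ℝ)..1, (θx z / (2 * √(θ z))) ^ 2
      = (∫ z in (0:ℝ)..1, θx z ^ 2 / θ z) / 4 := by
    rw [← intervalIntegral.integral_div]
    apply intervalIntegral.integral_congr
    intro z hz
    rw [uIcc_of_le zero_le_one] at hz
    simp only
    rw [div_pow, mul_pow, Real.sq_sqrt (θpos z hz).le]
    have := (θpos z hz).ne'
    field_simp
    norm_num
  rw [he] at hc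
  have s1 := Real.sq_sqrt (θpos x hx).le
  have s2 := Real.sq_sqrt (θpos y hy).le
  have : 2 * E / M = 2 * (E / M) := by ring
  rw [this]
  nlinarith [sq_nonneg (√(θ x) - 2 * √(θ y))]

/-- The weighted temperature estimate, giving the dissipation bound. -/
lemma step_theta {T α C₀ R E M mb K ε Ce : ℝ} (hα : 0 < α) (hα' : α ≤ 1 / 2)
    (hC : 0 < C₀) (hR : 0 < R) (hM : 0 < M) (hK : 0 < K)
    (hε : ∀ N : ℝ, 0 ≤ N → N ^ (1 - α) ≤ ε * N + Ce)
    (hcond : 1 / 2 * R * E * (1 + K * ε) ≤ 2 * α * K / C₀)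
    (ρ ρx ρt u ux θ θx θt k qx D : ℝ → ℝ → ℝ)
    (cρ : Continuous (Function.uncurry ρ)) (cρt : Continuous (Function.uncurry ρt))
    (cux : Continuous (Function.uncurry ux))
    (cθ : Continuous (Function.uncurry θ)) (cθx : Continuous (Function.uncurry θx))
    (cθt : Continuous (Function.uncurry θt)) (cD : Continuous (Function.uncurry D))
    (ck : ContinuousOn (Function.uncurry k) (Icc 0 1 ×ˢ Icc 0 T))
    (hρx : ∀ x t, HasDerivAt (fun y => ρ y t) (ρx x t) x)
    (hρt : ∀ x t, HasDerivAt (fun s => ρ x s) (ρt x t) t)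
    (hux : ∀ x t, HasDerivAt (fun y => u y t) (ux x t) x)
    (hθx : ∀ x t, HasDerivAt (fun y => θ y t) (θx x t) x)
    (hθt : ∀ x t, HasDerivAt (fun s => θ x s) (θt x t) t)
    (hq : ∀ x ∈ Icc (0:ℝ) 1, ∀ t ∈ Icc (0:ℝ) T,
      HasDerivAt (fun y => k y t * θx y t) (qx x t) x)
    (mass : ∀ x ∈ Icc (0:ℝ) 1, ∀ t ∈ Icc (0:ℝ) T, ρt x t + ρx x t * u x t + ρ x t * ux x t = 0)
    (pde : ∀ x ∈ Icc (0:ℝ) 1, ∀ t ∈ Icc (0:ℝ) T,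
      ρ x t * θt x t + ρ x t * u x t * θx x t - qx x t = D x t - ρ x t * θ x t * ux x t)
    (ρpos : ∀ x ∈ Icc (0:ℝ) 1, ∀ t ∈ Icc (0:ℝ) T, 0 < ρ x t)
    (θpos : ∀ x ∈ Icc (0:ℝ) 1, ∀ t ∈ Icc (0:ℝ) T, 0 < θ x t)
    (kpos : ∀ x ∈ Icc (0:ℝ) 1, ∀ t ∈ Icc (0:ℝ) T, C₀⁻¹ * θ x t ^ α ≤ k x t)
    (hD : ∀ x ∈ Icc (0:ℝ) 1, ∀ t ∈ Icc (0:ℝ) T, ux x t ^ 2 ≤ D x t)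
    (u0 : ∀ t ∈ Icc (0:ℝ) T, u 0 t = 0) (u1 : ∀ t ∈ Icc (0:ℝ) T, u 1 t = 0)
    (θ0 : ∀ t ∈ Icc (0:ℝ) T, θx 0 t = 0) (θ1 : ∀ t ∈ Icc (0:ℝ) T, θx 1 t = 0)
    (hρR : ∀ x ∈ Icc (0:ℝ) 1, ∀ t ∈ Icc (0:ℝ) T, ρ x t ≤ R)
    (hmb : ∀ t ∈ Icc (0:ℝ) T, ∫ x in (0:ℝ)..1, ρ x t ≤ mb)
    (hMm : ∀ t ∈ Icc (0:ℝ) T, M ≤ ∫ x in (0:ℝ)..1, ρ x t)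
    (hE : ∀ t ∈ Icc (0:ℝ) T, ∫ x in (0:ℝ)..1, ρ x t * θ x t ≤ E) :
    ∀ t ∈ Icc (0:ℝ) T, ∫ s in (0:ℝ)..t, ∫ x in (0:ℝ)..1, D x s ≤
      2 * (E + 2 * K * (mb + E) +
        T * |1 / 2 * R * E * K * Ce + 4 * α * K * E / (C₀ * M)|) := by
  intro t ht
  have cu : ∀ s, Continuous fun y => u y s := fun s =>
    continuous_iff_continuousAt.2 fun y => (hux y s).continuousAt
  have hsub : Icc (0:ℝ) 1 ×ˢ Icc (0:ℝ) t ⊆ Icc (0:ℝ) 1 ×ˢ Icc (0:ℝ) T :=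
    prod_mono le_rfl (Icc_subset_Icc le_rfl ht.2)
  have inT : ∀ s ∈ Icc (0:ℝ) t, s ∈ Icc (0:ℝ) T := fun s hs => ⟨hs.1, hs.2.trans ht.2⟩
  have crp : ∀ r : ℝ, ContinuousOn (fun p : ℝ × ℝ => θ p.1 p.2 ^ r)
      (Icc (0:ℝ) 1 ×ˢ Icc (0:ℝ) t) := by
    intro r
    apply ContinuousOn.rpow_const (by fun_prop)
    rintro ⟨x, s⟩ ⟨hx, hs⟩
    exact Or.inl (θpos x hx s (inT s hs)).ne'
  -- derivative of the weight
  have dH : ∀ y : ℝ, 0 < y →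
      HasDerivAt (fun z : ℝ => z + K * (z ^ (1 - α) / (1 - α))) (1 + K * y ^ (-α)) y := by
    intro y hy
    have h1 := (Real.hasDerivAt_rpow_const (x := y) (p := 1 - α) (Or.inl hy.ne')).div_const (1 - α)
    have h2 := (hasDerivAt_id y).add (h1.const_mul K)
    refine h2.congr_deriv ?_
    have : (1 - α) ≠ 0 := by linarith
    rw [show 1 - α - 1 = -α by ring]
    field_simp
  have dg : ∀ y : ℝ, 0 < y →
      HasDerivAt (fun z : ℝ => 1 + K * z ^ (-α)) (-(α * K * y ^ (-α - 1))) y := by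
    intro y hy
    have h1 := (Real.hasDerivAt_rpow_const (x := y) (p := -α) (Or.inl hy.ne'))
    have h2 := (h1.const_mul K).const_add 1
    refine h2.congr_deriv ?_
    ring
  have c1 : ContinuousOn (fun p : ℝ × ℝ => θ p.1 p.2 ^ (1 - α)) _ := crp (1 - α)
  have c2 : ContinuousOn (fun p : ℝ × ℝ => θ p.1 p.2 ^ (-α)) _ := crp (-α)
  have c3 : ContinuousOn (fun p : ℝ × ℝ => θ p.1 p.2 ^ (-α - 1)) _ := crp (-α - 1)
  have ck' : ContinuousOn (fun p : ℝ × ℝ => k p.1 p.2) (Icc (0:ℝ) 1 ×ˢ Icc (0:ℝ) t) :=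
    ck.mono hsub
  set S : ℝ → ℝ → ℝ := fun x s => (1 + K * θ x s ^ (-α)) * (D x s - ρ x s * θ x s * ux x s)
      + α * K * (k x s * θx x s ^ 2 * θ x s ^ (-α - 1)) with hS
  have cS : ContinuousOn (Function.uncurry S) (Icc 0 1 ×ˢ Icc 0 t) := by
    rw [hS]; unfold Function.uncurry
    apply ContinuousOn.add
    · apply ContinuousOn.mul
      · exact continuousOn_const.add (continuousOn_const.mul c2)
      · fun_prop
    · exact continuousOn_const.mul ((ck'.mul (by fun_prop)).mul c3)
  have key := balance (a := 1) (t := t) zero_le_one ht.1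
    (fun x s => ρ x s * (θ x s + K * (θ x s ^ (1 - α) / (1 - α))))
    (fun x s => ρt x s * (θ x s + K * (θ x s ^ (1 - α) / (1 - α)))
      + ρ x s * ((1 + K * θ x s ^ (-α)) * θt x s))
    (fun x s => ρ x s * u x s * (θ x s + K * (θ x s ^ (1 - α) / (1 - α)))
      - k x s * θx x s * (1 + K * θ x s ^ (-α)))
    S
    (by
      intro x hx s hs
      have hp := θpos x hx s (inT s hs)
      exact (hρt x s).mul ((dH _ hp).comp s (hθt x s)))
    (by
      intro x hx s hs
      have hp := θpos x hx s (inT s hs)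
      refine ((((hρx x s).mul (hux x s)).mul ((dH _ hp).comp x (hθx x s))).sub
        ((hq x hx s (inT s hs)).mul ((dg _ hp).comp x (hθx x s)))).congr_deriv ?_
      have e1 := mass x hx s (inT s hs)
      have e2 := pde x hx s (inT s hs)
      simp only [hS, Function.comp_apply, Pi.mul_apply]
      generalize θ x s ^ (-α - 1) = g1 at *
      generalize θ x s ^ (-α) = g2 at *
      generalize θ x s ^ (1 - α) / (1 - α) = g3 at *
      linear_combination (θ x s + K * g3) * e1 + (1 + K * g2) * e2)
    (by
      unfold Function.uncurry
      apply ContinuousOn.add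
      · apply ContinuousOn.mul (by fun_prop)
        exact ContinuousOn.add (by fun_prop) (continuousOn_const.mul (c1.div_const _))
      · apply ContinuousOn.mul (by fun_prop)
        exact ContinuousOn.mul (continuousOn_const.add (continuousOn_const.mul c2)) (by fun_prop))
    cS
  set P0 := 1 / 2 * R * E * K * Ce + 4 * α * K * E / (C₀ * M) with hP0
  have slt : ∀ (H : ℝ → ℝ → ℝ), ContinuousOn (Function.uncurry H) (Icc 0 1 ×ˢ Icc 0 t) →
      ∀ s ∈ Icc 0 t, ContinuousOn (fun x => H x s) (Icc 0 1) := by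
    intro H hH s hs
    exact hH.comp (f := fun x => (x, s)) (by fun_prop) (fun x hx => ⟨hx, hs⟩)
  have hlow : ∀ s ∈ Icc (0:ℝ) t, (∫ x in (0:ℝ)..1, D x s) / 2 - P0 ≤ ∫ x in (0:ℝ)..1, S x s := by
    intro s hs
    have hsT := inT s hs
    set I := ∫ z in (0:ℝ)..1, θx z s ^ 2 / θ z s with hI
    set N := 2 * E / M + I / 2 with hN
    have hθN : ∀ x ∈ Icc (0:ℝ) 1, θ x s ≤ N :=
      theta_bound hM (fun x => ρ x s) (fun x => θ x s) (fun x => θx x s) (by fun_prop)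
        (by fun_prop) (fun x => hθx x s) (fun x hx => ρpos x hx s hsT)
        (fun x hx => θpos x hx s hsT) (hMm s hsT) (hE s hsT)
    have N0 : 0 < N := lt_of_lt_of_le (θpos 0 (by simp) s hsT) (hθN 0 (by simp))
    set Z := N + K * (ε * N + Ce) with hZ
    have cI : ContinuousOn (fun x => θx x s ^ 2 / θ x s) (Icc 0 1) := by
      apply ContinuousOn.div (by fun_prop) (by fun_prop)
      intro x hx; exact (θpos x hx s hsT).ne'
    have h1 : ∫ x in (0:ℝ)..1, (1 / 2 * D x s - 1 / 2 * R * Z * (ρ x s * θ x s)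
        + α * K / C₀ * (θx x s ^ 2 / θ x s)) ≤ ∫ x in (0:ℝ)..1, S x s := by
      apply int_mono
      · exact ContinuousOn.add (by fun_prop) (continuousOn_const.mul cI)
      · exact slt S cS s hs
      intro x hx
      have hp := θpos x hx s hsT
      have hr := ρpos x hx s hsT
      have hd := hD x hx s hsT
      have hk := kpos x hx s hsT
      have hRR := hρR x hx s hsT
      have hθn := hθN x hx
      simp only [hS]
      have r1 : θ x s * θ x s ^ (-α) = θ x s ^ (1 - α) := by
        rw [sub_eq_add_neg, Real.rpow_add hp, Real.rpow_one]
      have r2 : θ x s ^ (1 - α) ≤ ε * N + Ce :=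
        (Real.rpow_le_rpow hp.le hθn (by linarith)).trans (hε N N0.le)
      have r3 : θ x s ^ α * θ x s ^ (-α - 1) = 1 / θ x s := by
        rw [← Real.rpow_add hp, show α + (-α - 1) = -1 by ring, Real.rpow_neg_one, one_div]
      have p1 : 0 < θ x s ^ (-α) := Real.rpow_pos_of_pos hp _
      have p2 : 0 < θ x s ^ (-α - 1) := Real.rpow_pos_of_pos hp _
      have q1 : α * K / C₀ * (θx x s ^ 2 / θ x s)
          ≤ α * K * (k x s * θx x s ^ 2 * θ x s ^ (-α - 1)) := by
        have a1 : α * K / C₀ * (θx x s ^ 2 / θ x s)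
          = α * K * ((C₀⁻¹ * θ x s ^ α) * θx x s ^ 2 * θ x s ^ (-α - 1)) := by
          rw [show (C₀⁻¹ * θ x s ^ α) * θx x s ^ 2 * θ x s ^ (-α - 1)
            = C₀⁻¹ * θx x s ^ 2 * (θ x s ^ α * θ x s ^ (-α - 1)) by ring, r3]
          ring
        rw [a1]
        gcongr
      have q2 : (1 + K * θ x s ^ (-α)) * (D x s / 2 - (ρ x s * θ x s) ^ 2 / 2)
          ≤ (1 + K * θ x s ^ (-α)) * (D x s - ρ x s * θ x s * ux x s) := by
        apply mul_le_mul_of_nonneg_left _ (by positivity)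
        nlinarith [sq_nonneg (ux x s - ρ x s * θ x s)]
      have D0 : 0 ≤ D x s := le_trans (sq_nonneg _) hd
      have q3 : 0 ≤ K * θ x s ^ (-α) * (D x s / 2) := by positivity
      have q4 : (1 + K * θ x s ^ (-α)) * (ρ x s * θ x s) ^ 2 ≤ R * Z * (ρ x s * θ x s) := by
        have a1 : (1 + K * θ x s ^ (-α)) * (ρ x s * θ x s) ^ 2
          = (ρ x s * θ x s) * (ρ x s * (θ x s + K * θ x s ^ (1 - α))) := by
          rw [← r1]; ring
        rw [a1, mul_comm (R * Z)]
        apply mul_le_mul_of_nonneg_left _ (by positivity)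
        apply mul_le_mul hRR _ (by positivity) hR.le
        rw [hZ]
        gcongr
      linarith
    have h2 : ∫ x in (0:ℝ)..1, (1 / 2 * D x s - 1 / 2 * R * Z * (ρ x s * θ x s)
        + α * K / C₀ * (θx x s ^ 2 / θ x s))
        = 1 / 2 * (∫ x in (0:ℝ)..1, D x s)
          - 1 / 2 * R * Z * (∫ x in (0:ℝ)..1, ρ x s * θ x s) + α * K / C₀ * I := by
      rw [intervalIntegral.integral_add, intervalIntegral.integral_sub,
        intervalIntegral.integral_const_mul, intervalIntegral.integral_const_mul,
        intervalIntegral.integral_const_mul]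
      · apply Continuous.intervalIntegrable; fun_prop
      · apply Continuous.intervalIntegrable; fun_prop
      · apply Continuous.intervalIntegrable; fun_prop
      · exact ii (continuousOn_const.mul cI)
    rw [h2] at h1
    have Z0 : 0 ≤ Z := by
      have := hε N N0.le
      have : 0 ≤ N ^ (1 - α) := Real.rpow_nonneg N0.le _
      rw [hZ]
      have : 0 ≤ ε * N + Ce := by linarith
      positivity
    have h3 : 1 / 2 * R * Z * (∫ x in (0:ℝ)..1, ρ x s * θ x s) ≤ 1 / 2 * R * Z * E :=
      mul_le_mul_of_nonneg_left (hE s hsT) (by positivity)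
    have h4 : α * K / C₀ * I = 2 * α * K / C₀ * N - 4 * α * K * E / (C₀ * M) := by
      rw [hN]; field_simp; ring
    have h5 := mul_le_mul_of_nonneg_right hcond N0.le
    have h6 : 1 / 2 * R * Z * E = 1 / 2 * R * E * (1 + K * ε) * N + 1 / 2 * R * E * K * Ce := by
      rw [hZ]; ring
    linarith
  have hup : ∫ x in (0:ℝ)..1, (ρ x t * (θ x t + K * (θ x t ^ (1 - α) / (1 - α)))
      - ρ x 0 * (θ x 0 + K * (θ x 0 ^ (1 - α) / (1 - α)))) ≤ E + 2 * K * (mb + E) := by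
    have z0 : (0:ℝ) ∈ Icc (0:ℝ) t := ⟨le_rfl, ht.1⟩
    have zt : t ∈ Icc (0:ℝ) t := ⟨ht.1, le_rfl⟩
    have cHs : ∀ s ∈ Icc (0:ℝ) t, ContinuousOn
        (fun x => ρ x s * (θ x s + K * (θ x s ^ (1 - α) / (1 - α)))) (Icc 0 1) := by
      intro s hs
      apply ContinuousOn.mul (by fun_prop)
      apply ContinuousOn.add (by fun_prop)
      exact continuousOn_const.mul ((slt (fun x s => θ x s ^ (1 - α)) c1 s hs).div_const _)
    have h1 : ∫ x in (0:ℝ)..1, (ρ x t * (θ x t + K * (θ x t ^ (1 - α) / (1 - α)))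
      - ρ x 0 * (θ x 0 + K * (θ x 0 ^ (1 - α) / (1 - α))))
      ≤ ∫ x in (0:ℝ)..1, (ρ x t * θ x t + 2 * K * (ρ x t + ρ x t * θ x t)) := by
      apply int_mono
      · exact (cHs t zt).sub (cHs 0 z0)
      · fun_prop
      intro x hx
      have hp := θpos x hx t ht
      have hr := ρpos x hx t ht
      have hp0 := θpos x hx 0 (inT 0 z0)
      have hr0 := ρpos x hx 0 (inT 0 z0)
      have a0 : 0 < 1 - α := by linarith
      have a1 : 0 ≤ ρ x 0 * (θ x 0 + K * (θ x 0 ^ (1 - α) / (1 - α))) := by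
        have := Real.rpow_pos_of_pos hp0 (1 - α)
        positivity
      have a2 : θ x t ^ (1 - α) ≤ 1 + θ x t := by
        rcases le_total (θ x t) 1 with h | h
        · have := Real.rpow_le_one hp.le h a0.le
          linarith
        · have := Real.rpow_le_rpow_of_exponent_le h (show 1 - α ≤ 1 by linarith)
          rw [Real.rpow_one] at this
          linarith
      have a3 : θ x t ^ (1 - α) / (1 - α) ≤ 2 * (1 + θ x t) := by
        rw [div_le_iff₀ a0]
        nlinarith
      have a4 : ρ x t * (θ x t + K * (θ x t ^ (1 - α) / (1 - α)))
        ≤ ρ x t * (θ x t + K * (2 * (1 + θ x t))) := by gcongr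
      linarith
    rw [intervalIntegral.integral_add, intervalIntegral.integral_const_mul,
      intervalIntegral.integral_add] at h1
    rotate_left
    · apply Continuous.intervalIntegrable; fun_prop
    · apply Continuous.intervalIntegrable; fun_prop
    · apply Continuous.intervalIntegrable; fun_prop
    · apply Continuous.intervalIntegrable; fun_prop
    have e1 := hE t ht
    have e2 := hmb t ht
    have e3 := mul_le_mul_of_nonneg_left (add_le_add e2 e1) (show 0 ≤ 2 * K by positivity)
    linarith
  rw [key] at hup
  have hcS : ContinuousOn (fun s => ∫ x in (0:ℝ)..1, S x s) (Icc 0 t) := par_cont ht.1 S cS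
  have e1 : ∫ s in (0:ℝ)..t, ((∫ x in (0:ℝ)..1, D x s) / 2 - P0) ≤
      ∫ s in (0:ℝ)..t, ((∫ x in (0:ℝ)..1, S x s) -
      (ρ 1 s * u 1 s * (θ 1 s + K * (θ 1 s ^ (1 - α) / (1 - α)))
      - k 1 s * θx 1 s * (1 + K * θ 1 s ^ (-α))
      - (ρ 0 s * u 0 s * (θ 0 s + K * (θ 0 s ^ (1 - α) / (1 - α)))
      - k 0 s * θx 0 s * (1 + K * θ 0 s ^ (-α))))) := by
    have e2 : ∫ s in (0:ℝ)..t, ((∫ x in (0:ℝ)..1, S x s) -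
      (ρ 1 s * u 1 s * (θ 1 s + K * (θ 1 s ^ (1 - α) / (1 - α)))
      - k 1 s * θx 1 s * (1 + K * θ 1 s ^ (-α))
      - (ρ 0 s * u 0 s * (θ 0 s + K * (θ 0 s ^ (1 - α) / (1 - α)))
      - k 0 s * θx 0 s * (1 + K * θ 0 s ^ (-α))))) = ∫ s in (0:ℝ)..t, (∫ x in (0:ℝ)..1, S x s) := by
      apply intervalIntegral.integral_congr
      intro s hs
      rw [uIcc_of_le ht.1] at hs
      have hsT := inT s hs
      simp only
      rw [u0 s hsT, u1 s hsT, θ0 s hsT, θ1 s hsT]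
      ring
    rw [e2]
    apply intervalIntegral.integral_mono_on ht.1 _ _ hlow
    · apply Continuous.intervalIntegrable; fun_prop
    · apply ContinuousOn.intervalIntegrable; rw [uIcc_of_le ht.1]; exact hcS
  have e3 : ∫ s in (0:ℝ)..t, ((∫ x in (0:ℝ)..1, D x s) / 2 - P0)
      = (∫ s in (0:ℝ)..t, ∫ x in (0:ℝ)..1, D x s) / 2 - t * P0 := by
    rw [intervalIntegral.integral_sub, intervalIntegral.integral_div]
    · simp
    · apply Continuous.intervalIntegrable; fun_prop
    · simp
  rw [e3] at e1
  have e4 : t * P0 ≤ T * |P0| := by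
    calc t * P0 ≤ t * |P0| := mul_le_mul_of_nonneg_left (le_abs_self _) ht.1
      _ ≤ T * |P0| := mul_le_mul_of_nonneg_right ht.2 (abs_nonneg _)
  linarith

/-- Conservation of mass. -/
lemma step_mass {T : ℝ} (ρ ρx ρt u ux : ℝ → ℝ → ℝ)
    (cρ : Continuous (Function.uncurry ρ)) (cρt : Continuous (Function.uncurry ρt))
    (hρx : ∀ x t, HasDerivAt (fun y => ρ y t) (ρx x t) x)
    (hρt : ∀ x t, HasDerivAt (fun s => ρ x s) (ρt x t) t)
    (hux : ∀ x t, HasDerivAt (fun y => u y t) (ux x t) x)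
    (mass : ∀ x ∈ Icc (0:ℝ) 1, ∀ t ∈ Icc (0:ℝ) T, ρt x t + ρx x t * u x t + ρ x t * ux x t = 0)
    (u0 : ∀ t ∈ Icc (0:ℝ) T, u 0 t = 0) (u1 : ∀ t ∈ Icc (0:ℝ) T, u 1 t = 0) :
    ∀ t ∈ Icc (0:ℝ) T, ∫ x in (0:ℝ)..1, ρ x t = ∫ x in (0:ℝ)..1, ρ x 0 := by
  intro t ht
  have key := balance (a := 1) (t := t) zero_le_one ht.1 ρ ρt (fun x s => ρ x s * u x s)
    (fun _ _ => 0) (fun x _ s _ => hρt x s)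
    (fun x hx s hs => by
      refine ((hρx x s).mul (hux x s)).congr_deriv ?_
      linarith [mass x hx s ⟨hs.1, hs.2.trans ht.2⟩])
    cρt.continuousOn (by unfold Function.uncurry; fun_prop)
  have e : ∫ s in (0:ℝ)..t, ((∫ x in (0:ℝ)..1, (fun _ _ => (0:ℝ)) x s)
      - (ρ 1 s * u 1 s - ρ 0 s * u 0 s)) = ∫ s in (0:ℝ)..t, (0:ℝ) := by
    apply intervalIntegral.integral_congr
    intro s hs
    rw [uIcc_of_le ht.1] at hs
    have hsT : s ∈ Icc (0:ℝ) T := ⟨hs.1, hs.2.trans ht.2⟩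
    simp [u0 s hsT, u1 s hsT]
  rw [e, intervalIntegral.integral_zero, intervalIntegral.integral_sub] at key
  · linarith
  · apply Continuous.intervalIntegrable; fun_prop
  · apply Continuous.intervalIntegrable; fun_prop

/-- Conservation of energy. -/
lemma step_energy {T : ℝ}
    (ρ ρx ρt u ux uxx ut θ θx θt q qx w wx wxx wt v vx vxx vt b bx bxx bt c cx cxx ct :
      ℝ → ℝ → ℝ)
    (kρ : Continuous (Function.uncurry ρ)) (kρt : Continuous (Function.uncurry ρt))
    (ku : Continuous (Function.uncurry u)) (kut : Continuous (Function.uncurry ut))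
    (kθ : Continuous (Function.uncurry θ)) (kθt : Continuous (Function.uncurry θt))
    (kw : Continuous (Function.uncurry w)) (kwt : Continuous (Function.uncurry wt))
    (kv : Continuous (Function.uncurry v)) (kvt : Continuous (Function.uncurry vt))
    (kb : Continuous (Function.uncurry b)) (kbt : Continuous (Function.uncurry bt))
    (kc : Continuous (Function.uncurry c)) (kct : Continuous (Function.uncurry ct))
    (hρx : ∀ x t, HasDerivAt (fun y => ρ y t) (ρx x t) x)
    (hρt : ∀ x t, HasDerivAt (fun s => ρ x s) (ρt x t) t)
    (hux : ∀ x t, HasDerivAt (fun y => u y t) (ux x t) x)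
    (huxx : ∀ x t, HasDerivAt (fun y => ux y t) (uxx x t) x)
    (hut : ∀ x t, HasDerivAt (fun s => u x s) (ut x t) t)
    (hθx : ∀ x t, HasDerivAt (fun y => θ y t) (θx x t) x)
    (hθt : ∀ x t, HasDerivAt (fun s => θ x s) (θt x t) t)
    (hq : ∀ x ∈ Icc (0:ℝ) 1, ∀ t ∈ Icc (0:ℝ) T, HasDerivAt (fun y => q y t) (qx x t) x)
    (hwx : ∀ x t, HasDerivAt (fun y => w y t) (wx x t) x)
    (hwxx : ∀ x t, HasDerivAt (fun y => wx y t) (wxx x t) x)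
    (hwt : ∀ x t, HasDerivAt (fun s => w x s) (wt x t) t)
    (hvx : ∀ x t, HasDerivAt (fun y => v y t) (vx x t) x)
    (hvxx : ∀ x t, HasDerivAt (fun y => vx y t) (vxx x t) x)
    (hvt : ∀ x t, HasDerivAt (fun s => v x s) (vt x t) t)
    (hbx : ∀ x t, HasDerivAt (fun y => b y t) (bx x t) x)
    (hbxx : ∀ x t, HasDerivAt (fun y => bx y t) (bxx x t) x)
    (hbt : ∀ x t, HasDerivAt (fun s => b x s) (bt x t) t)
    (hcx : ∀ x t, HasDerivAt (fun y => c y t) (cx x t) x)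
    (hcxx : ∀ x t, HasDerivAt (fun y => cx y t) (cxx x t) x)
    (hct : ∀ x t, HasDerivAt (fun s => c x s) (ct x t) t)
    (mass : ∀ x ∈ Icc (0:ℝ) 1, ∀ t ∈ Icc (0:ℝ) T, ρt x t + ρx x t * u x t + ρ x t * ux x t = 0)
    (mom : ∀ x ∈ Icc (0:ℝ) 1, ∀ t ∈ Icc (0:ℝ) T,
      ρ x t * ut x t + ρ x t * u x t * ux x t + ρx x t * θ x t + ρ x t * θx x t
        + b x t * bx x t + c x t * cx x t = uxx x t)
    (eqw : ∀ x ∈ Icc (0:ℝ) 1, ∀ t ∈ Icc (0:ℝ) T,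
      ρ x t * wt x t + ρ x t * u x t * wx x t - bx x t = wxx x t)
    (eqv : ∀ x ∈ Icc (0:ℝ) 1, ∀ t ∈ Icc (0:ℝ) T,
      ρ x t * vt x t + ρ x t * u x t * vx x t - cx x t = vxx x t)
    (eqb : ∀ x ∈ Icc (0:ℝ) 1, ∀ t ∈ Icc (0:ℝ) T,
      bt x t + ux x t * b x t + u x t * bx x t - wx x t = bxx x t)
    (eqc : ∀ x ∈ Icc (0:ℝ) 1, ∀ t ∈ Icc (0:ℝ) T,
      ct x t + ux x t * c x t + u x t * cx x t - vx x t = cxx x t)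
    (eqθ : ∀ x ∈ Icc (0:ℝ) 1, ∀ t ∈ Icc (0:ℝ) T,
      ρ x t * θt x t + ρ x t * u x t * θx x t - qx x t
        = ux x t ^ 2 + wx x t ^ 2 + vx x t ^ 2 + bx x t ^ 2 + cx x t ^ 2
          - ρ x t * θ x t * ux x t)
    (u0 : ∀ t ∈ Icc (0:ℝ) T, u 0 t = 0 ∧ u 1 t = 0)
    (w0 : ∀ t ∈ Icc (0:ℝ) T, w 0 t = 0 ∧ w 1 t = 0)
    (v0 : ∀ t ∈ Icc (0:ℝ) T, v 0 t = 0 ∧ v 1 t = 0)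
    (b0 : ∀ t ∈ Icc (0:ℝ) T, b 0 t = 0 ∧ b 1 t = 0)
    (c0 : ∀ t ∈ Icc (0:ℝ) T, c 0 t = 0 ∧ c 1 t = 0)
    (q0 : ∀ t ∈ Icc (0:ℝ) T, q 0 t = 0 ∧ q 1 t = 0) :
    ∀ t ∈ Icc (0:ℝ) T,
      ∫ x in (0:ℝ)..1, (ρ x t * (θ x t + (u x t ^ 2 + w x t ^ 2 + v x t ^ 2) / 2)
        + (b x t ^ 2 + c x t ^ 2) / 2)
      = ∫ x in (0:ℝ)..1, (ρ x 0 * (θ x 0 + (u x 0 ^ 2 + w x 0 ^ 2 + v x 0 ^ 2) / 2)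
        + (b x 0 ^ 2 + c x 0 ^ 2) / 2) := by
  intro t ht
  set G : ℝ → ℝ → ℝ := fun x s => ρ x s * u x s * (θ x s + (u x s ^ 2 + w x s ^ 2 + v x s ^ 2) / 2)
      - q x s - u x s * ux x s - w x s * wx x s - v x s * vx x s - b x s * bx x s - c x s * cx x s
      + u x s * (ρ x s * θ x s) - w x s * b x s - v x s * c x s
      + u x s * (b x s ^ 2 + c x s ^ 2) with hG
  have key := balance (a := 1) (t := t) zero_le_one ht.1
    (fun x s => ρ x s * (θ x s + (u x s ^ 2 + w x s ^ 2 + v x s ^ 2) / 2)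
        + (b x s ^ 2 + c x s ^ 2) / 2)
    (fun x s => ρt x s * (θ x s + (u x s ^ 2 + w x s ^ 2 + v x s ^ 2) / 2)
        + ρ x s * (θt x s + (u x s * ut x s + w x s * wt x s + v x s * vt x s))
        + (b x s * bt x s + c x s * ct x s))
    G
    (fun _ _ => 0)
    (fun x _ s _ => by
      refine (((hρt x s).mul ((hθt x s).add ((((hd_sq (hut x s)).add (hd_sq (hwt x s))).add
        (hd_sq (hvt x s))).div_const 2))).add
        (((hd_sq (hbt x s)).add (hd_sq (hct x s))).div_const 2)).congr_deriv ?_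
      simp only [Pi.add_apply]
      ring)
    (fun x hx s hs => by
      have hsT : s ∈ Icc (0:ℝ) T := ⟨hs.1, hs.2.trans ht.2⟩
      have d1 := ((hρx x s).mul (hux x s)).mul
        ((hθx x s).add ((((hd_sq (hux x s)).add (hd_sq (hwx x s))).add
        (hd_sq (hvx x s))).div_const 2))
      have d2 := (((((((((d1.sub (hq x hx s hsT)).sub ((hux x s).mul (huxx x s))).sub
        ((hwx x s).mul (hwxx x s))).sub ((hvx x s).mul (hvxx x s))).sub
        ((hbx x s).mul (hbxx x s))).sub ((hcx x s).mul (hcxx x s))).add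
        ((hux x s).mul ((hρx x s).mul (hθx x s)))).sub ((hwx x s).mul (hbx x s))).sub
        ((hvx x s).mul (hcx x s))).add
        ((hux x s).mul ((hd_sq (hbx x s)).add (hd_sq (hcx x s))))
      refine d2.congr_deriv ?_
      simp only [Pi.add_apply, Pi.mul_apply]
      have e1 := mass x hx s hsT
      have e2 := mom x hx s hsT
      have e3 := eqw x hx s hsT
      have e4 := eqv x hx s hsT
      have e5 := eqb x hx s hsT
      have e6 := eqc x hx s hsT
      have e7 := eqθ x hx s hsT
      linear_combination (θ x s + (u x s ^ 2 + w x s ^ 2 + v x s ^ 2) / 2) * e1 + u x s * e2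
        + w x s * e3 + v x s * e4 + b x s * e5 + c x s * e6 + e7)
    (by apply Continuous.continuousOn; unfold Function.uncurry; fun_prop)
    (by unfold Function.uncurry; fun_prop)
  have e : ∫ s in (0:ℝ)..t, ((∫ x in (0:ℝ)..1, (fun _ _ => (0:ℝ)) x s)
      - (G 1 s - G 0 s)) = ∫ s in (0:ℝ)..t, (0:ℝ) := by
    apply intervalIntegral.integral_congr
    intro s hs
    rw [uIcc_of_le ht.1] at hs
    have hsT : s ∈ Icc (0:ℝ) T := ⟨hs.1, hs.2.trans ht.2⟩
    simp [hG, u0 s hsT, w0 s hsT, v0 s hsT, b0 s hsT, c0 s hsT, q0 s hsT]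
  rw [e, intervalIntegral.integral_zero, intervalIntegral.integral_sub] at key
  · linarith
  · apply Continuous.intervalIntegrable; fun_prop
  · apply Continuous.intervalIntegrable; fun_prop

lemma rpow_eps {α ε : ℝ} (hα : 0 < α) (hα' : α ≤ 1 / 2) (hε : 0 < ε) :
    ∃ Ce : ℝ, ∀ N : ℝ, 0 ≤ N → N ^ (1 - α) ≤ ε * N + Ce := by
  set L := ε ^ (-(1 / α)) with hL
  have L0 : 0 < L := Real.rpow_pos_of_pos hε _
  refine ⟨L ^ (1 - α), fun N hN => ?_⟩
  rcases le_total N L with h | h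
  · have := Real.rpow_le_rpow hN h (show 0 ≤ 1 - α by linarith)
    nlinarith
  · have N0 : 0 < N := lt_of_lt_of_le L0 h
    have e1 : N ^ (1 - α) = N * N ^ (-α) := by
      rw [sub_eq_add_neg, Real.rpow_add N0, Real.rpow_one]
    have e2 : N ^ (-α) ≤ L ^ (-α) := Real.rpow_le_rpow_of_nonpos L0 h (by linarith)
    have e3 : L ^ (-α) = ε := by
      rw [hL, ← Real.rpow_mul hε.le]
      rw [show -(1 / α) * -α = 1 by field_simp]
      exact Real.rpow_one _
    have e4 : 0 < L ^ (1 - α) := Real.rpow_pos_of_pos L0 _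
    rw [e3] at e2
    rw [e1]
    nlinarith

lemma six_sq (a b c d e f : ℝ) : (a + b + c + d + e + f) ^ 2
    ≤ 6 * (a ^ 2 + b ^ 2 + c ^ 2 + d ^ 2 + e ^ 2 + f ^ 2) := by
  have h : 6 * (a ^ 2 + b ^ 2 + c ^ 2 + d ^ 2 + e ^ 2 + f ^ 2) - (a + b + c + d + e + f) ^ 2
      = (a - b) ^ 2 + (a - c) ^ 2 + (a - d) ^ 2 + (a - e) ^ 2 + (a - f) ^ 2 + (b - c) ^ 2
        + (b - d) ^ 2 + (b - e) ^ 2 + (b - f) ^ 2 + (c - d) ^ 2 + (c - e) ^ 2 + (c - f) ^ 2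
        + (d - e) ^ 2 + (d - f) ^ 2 + (e - f) ^ 2 := by ring
  rw [← sub_nonneg, h]
  positivity

set_option maxHeartbeats 1000000 in
/-- The final elliptic estimate at a fixed time. -/
lemma step_final {R C₀ Y Θ : ℝ} (hC₀ : 1 ≤ C₀) (hR : 0 < R) (hY : 0 ≤ Y)
    (r rx u ux uxx ut θ θx k b bx c cx : ℝ → ℝ)
    (kr : Continuous r) (krx : Continuous rx) (kux : Continuous ux)
    (kuxx : Continuous uxx) (kut : Continuous ut) (kθx : Continuous θx)
    (kk : ContinuousOn k (Icc 0 1)) (kbx : Continuous bx) (kcx : Continuous cx)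
    (hux : ∀ x, HasDerivAt u (ux x) x) (hbx : ∀ x, HasDerivAt b (bx x) x)
    (hcx : ∀ x, HasDerivAt c (cx x) x)
    (u0 : u 0 = 0) (b0 : b 0 = 0) (c0 : c 0 = 0)
    (mom : ∀ x ∈ Icc (0:ℝ) 1,
      r x * ut x + r x * u x * ux x + rx x * θ x + r x * θx x
        + b x * bx x + c x * cx x = uxx x)
    (rpos : ∀ x ∈ Icc (0:ℝ) 1, 0 < r x) (θpos : ∀ x ∈ Icc (0:ℝ) 1, 0 < θ x)
    (hrR : ∀ x ∈ Icc (0:ℝ) 1, r x ≤ R) (hθ : ∀ x ∈ Icc (0:ℝ) 1, θ x ≤ Θ)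
    (hk : ∀ x ∈ Icc (0:ℝ) 1, C₀⁻¹ ≤ k x)
    (hb : ∫ x in (0:ℝ)..1, bx x ^ 2 ≤ Y) (hc : ∫ x in (0:ℝ)..1, cx x ^ 2 ≤ Y) :
    L2norm uxx ≤ (6 * (R + R ^ 2 + 1 + R ^ 2 * C₀ ^ 2 + 2 * Y ^ 2)) *
      (1 + L2norm (fun x => √(r x) * ut x) + (L2norm ux) ^ 2 + L2norm (fun x => k x * θx x)
        + L2norm rx * Θ) := by
  have Θ0 : 0 < Θ := lt_of_lt_of_le (θpos 0 (by simp)) (hθ 0 (by simp))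
  have hsq : ∀ f : ℝ → ℝ, L2norm f ^ 2 = ∫ x in (0:ℝ)..1, f x ^ 2 := fun f =>
    Real.sq_sqrt (int_nonneg (fun x _ => sq_nonneg _))
  have hnn : ∀ f : ℝ → ℝ, 0 ≤ L2norm f := fun f => Real.sqrt_nonneg _
  set a1 := L2norm (fun x => √(r x) * ut x) with ha1
  set U := L2norm ux ^ 2 with hU
  set a3 := L2norm (fun x => k x * θx x) with ha3
  set a4 := L2norm rx with ha4
  have Ueq : U = ∫ x in (0:ℝ)..1, ux x ^ 2 := hsq ux
  have ckx : ContinuousOn (fun x => (k x * θx x) ^ 2) (Icc 0 1) := (kk.mul kθx.continuousOn).pow 2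
  have main : ∫ x in (0:ℝ)..1, uxx x ^ 2 ≤ ∫ x in (0:ℝ)..1,
      6 * (R * (√(r x) * ut x) ^ 2 + R ^ 2 * U * ux x ^ 2 + Θ ^ 2 * rx x ^ 2
        + R ^ 2 * C₀ ^ 2 * (k x * θx x) ^ 2 + Y * bx x ^ 2 + Y * cx x ^ 2) := by
    apply int_mono
    · fun_prop
    · exact continuousOn_const.mul (((ContinuousOn.add (by fun_prop)
        (continuousOn_const.mul ckx)).add (by fun_prop)).add (by fun_prop))
    intro x hx
    have hr := rpos x hx
    have hrR' := hrR x hx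
    have g1 : (r x * ut x) ^ 2 ≤ R * (√(r x) * ut x) ^ 2 := by
      rw [mul_pow, mul_pow, Real.sq_sqrt hr.le, pow_two (r x), mul_assoc]
      apply mul_le_mul_of_nonneg_right hrR'
      positivity
    have hu2 : u x ^ 2 ≤ U := by
      have := cs (fun z _ => hux z) (by fun_prop) hx (y := 0) (by simp)
      rw [u0, sub_zero] at this
      rw [Ueq]; exact this
    have hb2 : b x ^ 2 ≤ Y := by
      have := cs (fun z _ => hbx z) (by fun_prop) hx (y := 0) (by simp)
      rw [b0, sub_zero] at this
      exact this.trans hb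
    have hc2 : c x ^ 2 ≤ Y := by
      have := cs (fun z _ => hcx z) (by fun_prop) hx (y := 0) (by simp)
      rw [c0, sub_zero] at this
      exact this.trans hc
    have hr2 : r x ^ 2 ≤ R ^ 2 := by gcongr
    have g2 : (r x * u x * ux x) ^ 2 ≤ R ^ 2 * U * ux x ^ 2 := by
      rw [mul_pow, mul_pow]; gcongr
    have g3 : (rx x * θ x) ^ 2 ≤ Θ ^ 2 * rx x ^ 2 := by
      rw [mul_pow, mul_comm]
      have := (θpos x hx).le
      have := hθ x hx
      gcongr
    have g4 : (r x * θx x) ^ 2 ≤ R ^ 2 * C₀ ^ 2 * (k x * θx x) ^ 2 := by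
      have h1 : 1 ≤ C₀ * k x := by
        have := mul_le_mul_of_nonneg_left (hk x hx) (show 0 ≤ C₀ by linarith)
        rwa [mul_inv_cancel₀ (by linarith)] at this
      have h2 : 1 ≤ (C₀ * k x) ^ 2 := one_le_pow₀ h1
      calc (r x * θx x) ^ 2 = r x ^ 2 * θx x ^ 2 * 1 := by ring
        _ ≤ R ^ 2 * θx x ^ 2 * (C₀ * k x) ^ 2 := by gcongr
        _ = _ := by ring
    have g5 : (b x * bx x) ^ 2 ≤ Y * bx x ^ 2 := by rw [mul_pow]; gcongr
    have g6 : (c x * cx x) ^ 2 ≤ Y * cx x ^ 2 := by rw [mul_pow]; gcongr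
    rw [← mom x hx]
    refine (six_sq _ _ _ _ _ _).trans ?_
    linarith
  have eqn : ∫ x in (0:ℝ)..1,
      6 * (R * (√(r x) * ut x) ^ 2 + R ^ 2 * U * ux x ^ 2 + Θ ^ 2 * rx x ^ 2
        + R ^ 2 * C₀ ^ 2 * (k x * θx x) ^ 2 + Y * bx x ^ 2 + Y * cx x ^ 2)
      = 6 * (R * a1 ^ 2 + R ^ 2 * U * U + Θ ^ 2 * a4 ^ 2 + R ^ 2 * C₀ ^ 2 * a3 ^ 2
        + Y * (∫ x in (0:ℝ)..1, bx x ^ 2) + Y * (∫ x in (0:ℝ)..1, cx x ^ 2)) := by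
    have i1 : IntervalIntegrable (fun x => R * (√(r x) * ut x) ^ 2) volume 0 1 := by
      apply Continuous.intervalIntegrable; fun_prop
    have i2 : IntervalIntegrable (fun x => R ^ 2 * U * ux x ^ 2) volume 0 1 := by
      apply Continuous.intervalIntegrable; fun_prop
    have i3 : IntervalIntegrable (fun x => Θ ^ 2 * rx x ^ 2) volume 0 1 := by
      apply Continuous.intervalIntegrable; fun_prop
    have i4 : IntervalIntegrable (fun x => R ^ 2 * C₀ ^ 2 * (k x * θx x) ^ 2) volume 0 1 :=
      ii (continuousOn_const.mul ckx)
    have i5 : IntervalIntegrable (fun x => Y * bx x ^ 2) volume 0 1 := by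
      apply Continuous.intervalIntegrable; fun_prop
    have i6 : IntervalIntegrable (fun x => Y * cx x ^ 2) volume 0 1 := by
      apply Continuous.intervalIntegrable; fun_prop
    rw [intervalIntegral.integral_const_mul,
      intervalIntegral.integral_add ((((i1.add i2).add i3).add i4).add i5) i6,
      intervalIntegral.integral_add (((i1.add i2).add i3).add i4) i5,
      intervalIntegral.integral_add ((i1.add i2).add i3) i4,
      intervalIntegral.integral_add (i1.add i2) i3,
      intervalIntegral.integral_add i1 i2]
    simp only [intervalIntegral.integral_const_mul]
    rw [ha1, ha3, ha4, hsq, hsq, hsq, ← Ueq]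
  rw [eqn] at main
  set Sg := 1 + a1 + U + a3 + a4 * Θ with hSg
  have n1 : 0 ≤ a1 := hnn _
  have n2 : 0 ≤ U := sq_nonneg _
  have n3 : 0 ≤ a3 := hnn _
  have n4 : 0 ≤ a4 * Θ := mul_nonneg (hnn _) Θ0.le
  have s1 : a1 ^ 2 ≤ Sg ^ 2 := by gcongr; linarith
  have s2 : U ^ 2 ≤ Sg ^ 2 := by gcongr; linarith
  have s3 : a3 ^ 2 ≤ Sg ^ 2 := by gcongr; linarith
  have s4 : (a4 * Θ) ^ 2 ≤ Sg ^ 2 := by gcongr; linarith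
  have s5 : 1 ≤ Sg ^ 2 := one_le_pow₀ (by linarith)
  have y1 : Y * (∫ x in (0:ℝ)..1, bx x ^ 2) ≤ Y ^ 2 * Sg ^ 2 :=
    calc _ ≤ Y * Y := mul_le_mul_of_nonneg_left hb hY
      _ = Y ^ 2 * 1 := by ring
      _ ≤ _ := by gcongr
  have y2 : Y * (∫ x in (0:ℝ)..1, cx x ^ 2) ≤ Y ^ 2 * Sg ^ 2 :=
    calc _ ≤ Y * Y := mul_le_mul_of_nonneg_left hc hY
      _ = Y ^ 2 * 1 := by ring
      _ ≤ _ := by gcongr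
  have t1 := mul_le_mul_of_nonneg_left s1 hR.le
  have t2 := mul_le_mul_of_nonneg_left s2 (sq_nonneg R)
  have t3 := mul_le_mul_of_nonneg_left s3 (show 0 ≤ R ^ 2 * C₀ ^ 2 by positivity)
  set K := 6 * (R + R ^ 2 + 1 + R ^ 2 * C₀ ^ 2 + 2 * Y ^ 2) with hK
  have K1 : 1 ≤ K := by
    have : 0 ≤ R ^ 2 * C₀ ^ 2 := by positivity
    have : 0 ≤ R ^ 2 := by positivity
    have : 0 ≤ Y ^ 2 := by positivity
    linarith
  have f1 : ∫ x in (0:ℝ)..1, uxx x ^ 2 ≤ K * Sg ^ 2 := by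
    refine main.trans ?_
    rw [hK]
    linarith
  have f2 : K * Sg ^ 2 ≤ (K * Sg) ^ 2 := by
    rw [mul_pow]
    apply mul_le_mul_of_nonneg_right _ (sq_nonneg _)
    rw [pow_two]
    exact le_mul_of_one_le_left (by linarith) K1
  exact Real.sqrt_le_iff.2 ⟨by positivity, f1.trans f2⟩

lemma sol_mass {T : ℝ} {κ : ℝ → ℝ} (sol : MHDSol T κ) :
    ∀ x ∈ Icc (0:ℝ) 1, ∀ t ∈ Icc (0:ℝ) T,
      pdt sol.ρ x t + pdx sol.ρ x t * sol.u x t + sol.ρ x t * pdx sol.u x t = 0 := by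
  intro x hx t ht
  have h := sol.eq_mass x hx t ht
  have d : pdx (fun x t => sol.ρ x t * sol.u x t) x t = _ :=
    ((sm_hx sol.smooth_ρ x t).mul (sm_hx sol.smooth_u x t)).deriv
  rw [d] at h
  linarith

lemma sol_sumsq {T : ℝ} {κ : ℝ → ℝ} (sol : MHDSol T κ) (x t : ℝ) :
    HasDerivAt (fun y => (∑ i, (sol.b i y t) ^ 2) / 2)
      (sol.b 0 x t * pdx (sol.b 0) x t + sol.b 1 x t * pdx (sol.b 1) x t) x := by
  simp only [Fin.sum_univ_two]
  refine (((hd_sq (sm_hx (sol.smooth_b 0) x t)).add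
    (hd_sq (sm_hx (sol.smooth_b 1) x t))).div_const 2).congr_deriv ?_
  ring

lemma sol_flux {T : ℝ} {κ : ℝ → ℝ} (sol : MHDSol T κ) (x t : ℝ) :
    HasDerivAt (fun y => sol.ρ y t * (sol.u y t) ^ 2 + sol.ρ y t * sol.θ y t
        + (∑ i, (sol.b i y t) ^ 2) / 2)
      (pdx sol.ρ x t * sol.u x t ^ 2 + sol.ρ x t * (2 * sol.u x t * pdx sol.u x t)
        + (pdx sol.ρ x t * sol.θ x t + sol.ρ x t * pdx sol.θ x t)
        + (sol.b 0 x t * pdx (sol.b 0) x t + sol.b 1 x t * pdx (sol.b 1) x t)) x :=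
  ((((sm_hx sol.smooth_ρ x t).mul (hd_sq (sm_hx sol.smooth_u x t))).add
    ((sm_hx sol.smooth_ρ x t).mul (sm_hx sol.smooth_θ x t))).add (sol_sumsq sol x t))

lemma sol_mom {T : ℝ} {κ : ℝ → ℝ} (sol : MHDSol T κ) :
    ∀ x ∈ Icc (0:ℝ) 1, ∀ t ∈ Icc (0:ℝ) T,
      sol.ρ x t * pdt sol.u x t + sol.ρ x t * sol.u x t * pdx sol.u x t
        + pdx sol.ρ x t * sol.θ x t + sol.ρ x t * pdx sol.θ x t
        + sol.b 0 x t * pdx (sol.b 0) x t + sol.b 1 x t * pdx (sol.b 1) x t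
        = pdx (pdx sol.u) x t := by
  intro x hx t ht
  have h := sol.eq_mom x hx t ht
  have d : pdt (fun x t => sol.ρ x t * sol.u x t) x t = _ :=
    ((sm_ht sol.smooth_ρ x t).mul (sm_ht sol.smooth_u x t)).deriv
  have d2 : pdx (fun x t => sol.ρ x t * (sol.u x t) ^ 2 + sol.ρ x t * sol.θ x t
        + (∑ i, (sol.b i x t) ^ 2) / 2) x t = _ := (sol_flux sol x t).deriv
  rw [d, d2] at h
  linear_combination h - sol.u x t * sol_mass sol x hx t ht

lemma sol_w {T : ℝ} {κ : ℝ → ℝ} (sol : MHDSol T κ) (i : Fin 2) :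
    ∀ x ∈ Icc (0:ℝ) 1, ∀ t ∈ Icc (0:ℝ) T,
      sol.ρ x t * pdt (sol.w i) x t + sol.ρ x t * sol.u x t * pdx (sol.w i) x t
        - pdx (sol.b i) x t = pdx (pdx (sol.w i)) x t := by
  intro x hx t ht
  have h := sol.eq_w i x hx t ht
  have d : pdt (fun x t => sol.ρ x t * sol.w i x t) x t = _ :=
    ((sm_ht sol.smooth_ρ x t).mul (sm_ht (sol.smooth_w i) x t)).deriv
  have d2 : pdx (fun x t => sol.ρ x t * sol.u x t * sol.w i x t - sol.b i x t) x t = _ :=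
    ((((sm_hx sol.smooth_ρ x t).mul (sm_hx sol.smooth_u x t)).mul
      (sm_hx (sol.smooth_w i) x t)).sub (sm_hx (sol.smooth_b i) x t)).deriv
  rw [d, d2] at h
  simp only [Pi.mul_apply] at h
  linear_combination h - sol.w i x t * sol_mass sol x hx t ht

lemma sol_b {T : ℝ} {κ : ℝ → ℝ} (sol : MHDSol T κ) (i : Fin 2) :
    ∀ x ∈ Icc (0:ℝ) 1, ∀ t ∈ Icc (0:ℝ) T,
      pdt (sol.b i) x t + pdx sol.u x t * sol.b i x t + sol.u x t * pdx (sol.b i) x t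
        - pdx (sol.w i) x t = pdx (pdx (sol.b i)) x t := by
  intro x hx t ht
  have h := sol.eq_b i x hx t ht
  have d2 : pdx (fun x t => sol.u x t * sol.b i x t - sol.w i x t) x t = _ :=
    (((sm_hx sol.smooth_u x t).mul (sm_hx (sol.smooth_b i) x t)).sub
      (sm_hx (sol.smooth_w i) x t)).deriv
  rw [d2] at h
  linarith

lemma sol_th {T : ℝ} {κ : ℝ → ℝ} (sol : MHDSol T κ) :
    ∀ x ∈ Icc (0:ℝ) 1, ∀ t ∈ Icc (0:ℝ) T,
      sol.ρ x t * pdt sol.θ x t + sol.ρ x t * sol.u x t * pdx sol.θ x t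
        - pdx (fun x t => κ (sol.θ x t) * pdx sol.θ x t) x t
      = pdx sol.u x t ^ 2 + pdx (sol.w 0) x t ^ 2 + pdx (sol.w 1) x t ^ 2
        + pdx (sol.b 0) x t ^ 2 + pdx (sol.b 1) x t ^ 2
        - sol.ρ x t * sol.θ x t * pdx sol.u x t := by
  intro x hx t ht
  have h := sol.eq_θ x hx t ht
  have d : pdt (fun x t => sol.ρ x t * sol.θ x t) x t = _ :=
    ((sm_ht sol.smooth_ρ x t).mul (sm_ht sol.smooth_θ x t)).deriv
  have d2 : pdx (fun x t => sol.ρ x t * sol.u x t * sol.θ x t) x t = _ :=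
    (((sm_hx sol.smooth_ρ x t).mul (sm_hx sol.smooth_u x t)).mul
      (sm_hx sol.smooth_θ x t)).deriv
  rw [d, d2] at h
  simp only [Pi.mul_apply, Fin.sum_univ_two] at h
  linear_combination h - sol.θ x t * sol_mass sol x hx t ht

lemma sol_bt {T : ℝ} {κ : ℝ → ℝ} (hT : 0 < T) (sol : MHDSol T κ) (i : Fin 2) (x : ℝ)
    (h0 : ∀ t ∈ Icc (0:ℝ) T, sol.b i x t = 0) :
    ∀ t ∈ Icc (0:ℝ) T, pdt (sol.b i) x t = 0 := by
  intro t ht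
  have h1 := (sm_ht (sol.smooth_b i) x t).hasDerivWithinAt (s := Icc 0 T)
  have h2 : HasDerivWithinAt (fun s => sol.b i x s) 0 (Icc 0 T) t :=
    (hasDerivWithinAt_const t (Icc 0 T) (0:ℝ)).congr h0 (h0 t ht)
  exact (uniqueDiffOn_Icc hT t ht).eq_deriv _ h1 h2

lemma sol_kd {T q C₀ : ℝ} {κ : ℝ → ℝ} (hκ : KappaHyp q C₀ κ) (sol : MHDSol T κ) :
    ∀ x ∈ Icc (0:ℝ) 1, ∀ t ∈ Icc (0:ℝ) T,
      HasDerivAt (fun y => κ (sol.θ y t) * pdx sol.θ y t)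
        (pdx (fun x t => κ (sol.θ x t) * pdx sol.θ x t) x t) x := by
  intro x hx t ht
  have hp := sol.θ_pos x hx t ht
  have hk : DifferentiableAt ℝ κ (sol.θ x t) :=
    (hκ.1.contDiffAt (Ici_mem_nhds hp)).differentiableAt (by simp)
  have hc := hk.hasDerivAt.comp x (sm_hx sol.smooth_θ x t)
  exact (hc.mul (sm_hx (sm_pdx sol.smooth_θ) x t)).differentiableAt.hasDerivAt

lemma sol_kc {T q C₀ : ℝ} {κ : ℝ → ℝ} (hκ : KappaHyp q C₀ κ) (sol : MHDSol T κ) :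
    ContinuousOn (Function.uncurry fun x t => κ (sol.θ x t)) (Icc 0 1 ×ˢ Icc 0 T) :=
  hκ.1.continuousOn.comp sol.smooth_θ.continuous.continuousOn
    (fun p hp => (sol.θ_pos p.1 hp.1 p.2 hp.2).le)

lemma init_bd {f : ℝ → ℝ → ℝ} {A : ℝ} (hf : ContDiff ℝ (⊤ : ℕ∞) (Function.uncurry f))
    (h : H2norm (fun x => f x 0) ≤ A) :
    (∀ x ∈ Icc (0:ℝ) 1, f x 0 ^ 2 ≤ 2 * A ^ 2) ∧ (∀ x ∈ Icc (0:ℝ) 1, f x 0 ≤ 2 * |A|) ∧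
      ∫ x in (0:ℝ)..1, (pdx f x 0) ^ 2 ≤ A ^ 2 := by
  have hs : ContDiff ℝ (⊤ : ℕ∞) (fun x => f x 0) :=
    hf.comp (contDiff_id.prodMk contDiff_const)
  obtain ⟨h1, h2⟩ := sup_H2 hs h
  refine ⟨h1, fun x hx => ?_, h2⟩
  have := h1 x hx
  rw [← sq_abs A] at this
  by_contra hc
  push Not at hc
  nlinarith [abs_nonneg A]

set_option maxHeartbeats 1000000 in
/-- Mass and energy bounds, and the upper bound of the density. -/
lemma sol_basic {T q C₀ : ℝ} (hT : 0 < T) {κ : ℝ → ℝ} (hκ : KappaHyp q C₀ κ) {A B M : ℝ}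
    (sol : MHDSol T κ) (hI : InitBounds sol A B M) {E : ℝ}
    (hEdef : E = 6 * |A| ^ 2 + 6 * |A| ^ 3 + 1) :
    (∀ t ∈ Icc (0:ℝ) T, ∫ x in (0:ℝ)..1, sol.ρ x t ≤ 2 * |A|) ∧
    (∀ t ∈ Icc (0:ℝ) T, M ≤ ∫ x in (0:ℝ)..1, sol.ρ x t) ∧
    (∀ t ∈ Icc (0:ℝ) T, ∫ x in (0:ℝ)..1, sol.ρ x t * sol.θ x t ≤ E) ∧
    (∀ x ∈ Icc (0:ℝ) 1, ∀ t ∈ Icc (0:ℝ) T,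
      sol.ρ x t ≤ exp (2 * |A| + (2 * (2 * |A|) + 4 * E) + T * (2 * E) + T)) := by
  obtain ⟨iρ, iu, iθ, iw, ib, -, iM⟩ := hI
  have z0 : (0:ℝ) ∈ Icc (0:ℝ) T := ⟨le_rfl, hT.le⟩
  have kρ := sol.smooth_ρ.continuous
  have kρt := (sm_pdt sol.smooth_ρ).continuous
  have ku := sol.smooth_u.continuous
  have kux := (sm_pdx sol.smooth_u).continuous
  have kut := (sm_pdt sol.smooth_u).continuous
  have kθ := sol.smooth_θ.continuous
  have kw := (sol.smooth_w 0).continuous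
  have kv := (sol.smooth_w 1).continuous
  have kb := (sol.smooth_b 0).continuous
  have kc := (sol.smooth_b 1).continuous
  have hm := step_mass sol.ρ (pdx sol.ρ) (pdt sol.ρ) sol.u (pdx sol.u) kρ kρt
    (sm_hx sol.smooth_ρ) (sm_ht sol.smooth_ρ) (sm_hx sol.smooth_u) (sol_mass sol)
    (fun t ht => (sol.bc_u t ht).1) (fun t ht => (sol.bc_u t ht).2)
  have he := step_energy sol.ρ (pdx sol.ρ) (pdt sol.ρ) sol.u (pdx sol.u) (pdx (pdx sol.u))
    (pdt sol.u) sol.θ (pdx sol.θ) (pdt sol.θ) (fun x t => κ (sol.θ x t) * pdx sol.θ x t)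
    (pdx (fun x t => κ (sol.θ x t) * pdx sol.θ x t))
    (sol.w 0) (pdx (sol.w 0)) (pdx (pdx (sol.w 0))) (pdt (sol.w 0))
    (sol.w 1) (pdx (sol.w 1)) (pdx (pdx (sol.w 1))) (pdt (sol.w 1))
    (sol.b 0) (pdx (sol.b 0)) (pdx (pdx (sol.b 0))) (pdt (sol.b 0))
    (sol.b 1) (pdx (sol.b 1)) (pdx (pdx (sol.b 1))) (pdt (sol.b 1))
    kρ kρt ku kut kθ (sm_pdt sol.smooth_θ).continuous
    kw (sm_pdt (sol.smooth_w 0)).continuous kv (sm_pdt (sol.smooth_w 1)).continuous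
    kb (sm_pdt (sol.smooth_b 0)).continuous kc (sm_pdt (sol.smooth_b 1)).continuous
    (sm_hx sol.smooth_ρ) (sm_ht sol.smooth_ρ)
    (sm_hx sol.smooth_u) (sm_hx (sm_pdx sol.smooth_u)) (sm_ht sol.smooth_u)
    (sm_hx sol.smooth_θ) (sm_ht sol.smooth_θ) (sol_kd hκ sol)
    (sm_hx (sol.smooth_w 0)) (sm_hx (sm_pdx (sol.smooth_w 0))) (sm_ht (sol.smooth_w 0))
    (sm_hx (sol.smooth_w 1)) (sm_hx (sm_pdx (sol.smooth_w 1))) (sm_ht (sol.smooth_w 1))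
    (sm_hx (sol.smooth_b 0)) (sm_hx (sm_pdx (sol.smooth_b 0))) (sm_ht (sol.smooth_b 0))
    (sm_hx (sol.smooth_b 1)) (sm_hx (sm_pdx (sol.smooth_b 1))) (sm_ht (sol.smooth_b 1))
    (sol_mass sol) (sol_mom sol) (sol_w sol 0) (sol_w sol 1) (sol_b sol 0) (sol_b sol 1)
    (sol_th sol) sol.bc_u (sol.bc_w 0) (sol.bc_w 1) (sol.bc_b 0) (sol.bc_b 1)
    (fun t ht => by
      have := sol.bc_θ t ht
      simp [this.1, this.2])
  have a0 : 0 ≤ |A| := abs_nonneg A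
  have cF : ∀ t, Continuous (fun x => sol.ρ x t * (sol.θ x t + (sol.u x t ^ 2 + sol.w 0 x t ^ 2
      + sol.w 1 x t ^ 2) / 2) + (sol.b 0 x t ^ 2 + sol.b 1 x t ^ 2) / 2) := by
    intro t; fun_prop
  have hmb : ∀ t ∈ Icc (0:ℝ) T, ∫ x in (0:ℝ)..1, sol.ρ x t ≤ 2 * |A| := by
    intro t ht
    rw [hm t ht]
    have := int_mono (f := fun x => sol.ρ x 0) (g := fun _ => 2 * |A|) (by fun_prop) (by fun_prop)
      (init_bd sol.smooth_ρ iρ).2.1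
    simpa using this
  have hF : ∀ t ∈ Icc (0:ℝ) T, ∫ x in (0:ℝ)..1, (sol.ρ x t * (sol.θ x t + (sol.u x t ^ 2
      + sol.w 0 x t ^ 2 + sol.w 1 x t ^ 2) / 2) + (sol.b 0 x t ^ 2 + sol.b 1 x t ^ 2) / 2) ≤ E := by
    intro t ht
    rw [he t ht]
    have := int_mono (g := fun _ => E) (cF 0).continuousOn (by fun_prop) (by
      intro x hx
      have r1 := (init_bd sol.smooth_ρ iρ).2.1 x hx
      have r2 := (init_bd sol.smooth_θ iθ).2.1 x hx
      have r3 := (init_bd sol.smooth_u iu).1 x hx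
      have r4 := (init_bd (sol.smooth_w 0) (iw 0)).1 x hx
      have r5 := (init_bd (sol.smooth_w 1) (iw 1)).1 x hx
      have r6 := (init_bd (sol.smooth_b 0) (ib 0)).1 x hx
      have r7 := (init_bd (sol.smooth_b 1) (ib 1)).1 x hx
      rw [← sq_abs A] at r3 r4 r5 r6 r7
      have p1 := sol.ρ_pos x hx 0 z0
      have p2 := sol.θ_pos x hx 0 z0
      have m1 : sol.ρ x 0 * (sol.θ x 0 + (sol.u x 0 ^ 2 + sol.w 0 x 0 ^ 2
          + sol.w 1 x 0 ^ 2) / 2) ≤ (2 * |A|) * (2 * |A| + 3 * |A| ^ 2) := by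
        apply mul_le_mul r1 (by linarith) (by positivity) (by positivity)
      rw [hEdef]
      have m2 : (2 * |A|) * (2 * |A| + 3 * |A| ^ 2) = 4 * |A| ^ 2 + 6 * |A| ^ 3 := by ring
      linarith)
    simpa using this
  refine ⟨hmb, fun t ht => by rw [hm t ht]; exact iM, ?_, ?_⟩
  · intro t ht
    refine le_trans (int_mono ?_ (cF t).continuousOn ?_) (hF t ht)
    · fun_prop
    intro x hx
    have p1 := sol.ρ_pos x hx t ht
    have : 0 ≤ sol.ρ x t * ((sol.u x t ^ 2 + sol.w 0 x t ^ 2 + sol.w 1 x t ^ 2) / 2)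
      + (sol.b 0 x t ^ 2 + sol.b 1 x t ^ 2) / 2 := by positivity
    linarith
  · apply step_rho hT sol.ρ (pdx sol.ρ) (pdt sol.ρ) sol.u (pdx sol.u)
      (fun x t => sol.ρ x t * sol.θ x t + (sol.b 0 x t ^ 2 + sol.b 1 x t ^ 2) / 2)
      (fun x t => pdt sol.ρ x t * sol.u x t + sol.ρ x t * pdt sol.u x t)
      kρ ku kux (by unfold Function.uncurry; fun_prop) (by unfold Function.uncurry; fun_prop)
      (sm_hx sol.smooth_ρ) (sm_ht sol.smooth_ρ) (sm_hx sol.smooth_u)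
      (fun x t => (sm_ht sol.smooth_ρ x t).mul (sm_ht sol.smooth_u x t))
      ?_ (sol_mass sol) sol.ρ_pos ?_ (fun t ht => (sol.bc_u t ht).1)
      (fun t ht => (sol.bc_u t ht).2) hmb ?_ (init_bd sol.smooth_ρ iρ).2.1
    · intro x hx t ht
      refine ((((sm_hx sol.smooth_ρ x t).mul (hd_sq (sm_hx sol.smooth_u x t))).add
        (((sm_hx sol.smooth_ρ x t).mul (sm_hx sol.smooth_θ x t)).add
        (((hd_sq (sm_hx (sol.smooth_b 0) x t)).add
          (hd_sq (sm_hx (sol.smooth_b 1) x t))).div_const 2))).sub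
        (sm_hx (sm_pdx sol.smooth_u) x t)).congr_deriv ?_
      linear_combination sol_mom sol x hx t ht + sol.u x t * sol_mass sol x hx t ht
    · intro x hx t ht
      have p1 := sol.ρ_pos x hx t ht
      have p2 := sol.θ_pos x hx t ht
      positivity
    · intro t ht
      have h2 := hF t ht
      have h3 := int_mono (f := fun x => sol.ρ x t * sol.u x t ^ 2 + (sol.ρ x t * sol.θ x t
        + (sol.b 0 x t ^ 2 + sol.b 1 x t ^ 2) / 2))
        (g := fun x => 2 * (sol.ρ x t * (sol.θ x t + (sol.u x t ^ 2 + sol.w 0 x t ^ 2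
          + sol.w 1 x t ^ 2) / 2) + (sol.b 0 x t ^ 2 + sol.b 1 x t ^ 2) / 2)) (by fun_prop)
        ((continuous_const (y := (2:ℝ))).mul (cF t)).continuousOn (by
        intro x hx
        have p1 := sol.ρ_pos x hx t ht
        have p2 := sol.θ_pos x hx t ht
        have : 0 ≤ sol.ρ x t * sol.θ x t + sol.ρ x t * (sol.w 0 x t ^ 2 + sol.w 1 x t ^ 2)
          + (sol.b 0 x t ^ 2 + sol.b 1 x t ^ 2) / 2 := by positivity
        linarith)
      rw [intervalIntegral.integral_const_mul] at h3
      linarith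

lemma dbl_mono {T : ℝ} (f g : ℝ → ℝ → ℝ) (cf : Continuous (Function.uncurry f))
    (cg : Continuous (Function.uncurry g)) (h : ∀ x t, f x t ≤ g x t) {N : ℝ}
    (hN : ∀ t ∈ Icc (0:ℝ) T, ∫ s in (0:ℝ)..t, ∫ x in (0:ℝ)..1, g x s ≤ N) :
    ∀ t ∈ Icc (0:ℝ) T, ∫ s in (0:ℝ)..t, ∫ x in (0:ℝ)..1, f x s ≤ N := by
  intro t ht
  refine le_trans ?_ (hN t ht)
  apply intervalIntegral.integral_mono_on ht.1
  · apply Continuous.intervalIntegrable; fun_prop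
  · apply Continuous.intervalIntegrable; fun_prop
  · intro s _
    apply int_mono
    · fun_prop
    · fun_prop
    · intro x _; exact h x s

/-- estimate (2.22): there is a constant `C` depending only on
`T, q, C₀` and on the initial data (upper bound `A` for the `H²` norms, upper bound `B`
for `∫₀¹ ρ₀(|ln ρ₀| + |ln θ₀|) dx`, positive lower bound `M` for `∫₀¹ ρ₀ dx`), but not
on the pointwise lower bounds of `ρ₀` and `θ₀`, such that every smooth solution
satisfies, for every `t ∈ [0,T]`,
`‖u_{xx}‖_{L²} ≤ C (1 + ‖√ρ u_t‖_{L²} + ‖u_x‖²_{L²} + ‖κ(θ)θ_x‖_{L²}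
  + ‖ρ_x‖_{L²} · sup_x θ)`. -/
theorem stmt15 (T q C₀ : ℝ) (hT : 0 < T) (hq : 0 < q) (hC₀ : 1 ≤ C₀)
    (κ : ℝ → ℝ) (hκ : KappaHyp q C₀ κ) (A B M : ℝ) (hM : 0 < M) :
    ∃ C : ℝ, 0 < C ∧ ∀ sol : MHDSol T κ, InitBounds sol A B M →
      ∀ t ∈ Set.Icc (0:ℝ) T,
        L2norm (fun x => pdx (pdx sol.u) x t)
          ≤ C * (1 + L2norm (fun x => Real.sqrt (sol.ρ x t) * pdt sol.u x t)
            + (L2norm (fun x => pdx sol.u x t)) ^ 2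
            + L2norm (fun x => κ (sol.θ x t) * pdx sol.θ x t)
            + L2norm (fun x => pdx sol.ρ x t)
              * sSup ((fun x => sol.θ x t) '' Set.Icc (0:ℝ) 1)) := by
  set E : ℝ := 6 * |A| ^ 2 + 6 * |A| ^ 3 + 1 with hEdef
  have a0 : 0 ≤ |A| := abs_nonneg A
  have E0 : 0 < E := by positivity
  set R : ℝ := exp (2 * |A| + (2 * (2 * |A|) + 4 * E) + T * (2 * E) + T) with hRdef
  have R0 : 0 < R := exp_pos _
  have C0 : 0 < C₀ := by linarith
  set α : ℝ := min q (1 / 2) with hαdef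
  have α0 : 0 < α := lt_min hq (by norm_num)
  have α1 : α ≤ 1 / 2 := min_le_right _ _
  have αq : α ≤ q := min_le_left _ _
  set ε : ℝ := 2 * α / (C₀ * R * E) with hεdef
  have ε0 : 0 < ε := by positivity
  set K : ℝ := R * E * C₀ / (2 * α) with hKdef
  have K0 : 0 < K := by positivity
  have hcond : 1 / 2 * R * E * (1 + K * ε) ≤ 2 * α * K / C₀ := by
    have e1 : K * ε = 1 := by rw [hKdef, hεdef]; field_simp
    have e2 : 2 * α * K / C₀ = R * E := by rw [hKdef]; field_simp
    rw [e1, e2]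
    linarith
  obtain ⟨Ce, hCe⟩ := rpow_eps α0 α1 ε0
  set N : ℝ := 2 * (E + 2 * K * (2 * |A| + E) +
        T * |1 / 2 * R * E * K * Ce + 4 * α * K * E / (C₀ * M)|) with hN
  set Y : ℝ := exp (3 * N) * (A ^ 2 + 3 / 2 * N) with hY
  refine ⟨6 * (R + R ^ 2 + 1 + R ^ 2 * C₀ ^ 2 + 2 * Y ^ 2), by positivity, ?_⟩
  intro sol hI t ht
  obtain ⟨hmb, hMm, hρθ, hρR⟩ := sol_basic hT hκ sol hI hEdef
  have kθ := sol.smooth_θ.continuous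
  have kux := (sm_pdx sol.smooth_u).continuous
  have kw := (sm_pdx (sol.smooth_w 0)).continuous
  have kv := (sm_pdx (sol.smooth_w 1)).continuous
  have kb := (sm_pdx (sol.smooth_b 0)).continuous
  have kc := (sm_pdx (sol.smooth_b 1)).continuous
  have kD : Continuous (Function.uncurry fun x t => pdx sol.u x t ^ 2 + pdx (sol.w 0) x t ^ 2
      + pdx (sol.w 1) x t ^ 2 + pdx (sol.b 0) x t ^ 2 + pdx (sol.b 1) x t ^ 2) := by
    unfold Function.uncurry; fun_prop
  have hdiss := step_theta α0 α1 C0 R0 hM K0 hCe hcond sol.ρ (pdx sol.ρ) (pdt sol.ρ) sol.u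
    (pdx sol.u) sol.θ (pdx sol.θ) (pdt sol.θ) (fun x t => κ (sol.θ x t))
    (pdx (fun x t => κ (sol.θ x t) * pdx sol.θ x t))
    (fun x t => pdx sol.u x t ^ 2 + pdx (sol.w 0) x t ^ 2
      + pdx (sol.w 1) x t ^ 2 + pdx (sol.b 0) x t ^ 2 + pdx (sol.b 1) x t ^ 2)
    sol.smooth_ρ.continuous (sm_pdt sol.smooth_ρ).continuous kux kθ
    (sm_pdx sol.smooth_θ).continuous (sm_pdt sol.smooth_θ).continuous kD (sol_kc hκ sol)
    (sm_hx sol.smooth_ρ) (sm_ht sol.smooth_ρ) (sm_hx sol.smooth_u) (sm_hx sol.smooth_θ)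
    (sm_ht sol.smooth_θ) (sol_kd hκ sol) (sol_mass sol) (sol_th sol) sol.ρ_pos sol.θ_pos
    (by
      intro x hx s hs
      have hp := sol.θ_pos x hx s hs
      refine le_trans ?_ (hκ.2.1 _ hp.le)
      apply mul_le_mul_of_nonneg_left _ (by positivity)
      have hq0 : 0 < sol.θ x s ^ q := Real.rpow_pos_of_pos hp _
      rcases le_total (sol.θ x s) 1 with h1 | h1
      · have := Real.rpow_le_one hp.le h1 α0.le
        linarith
      · have := Real.rpow_le_rpow_of_exponent_le h1 αq
        linarith)
    (by
      intro x _ s _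
      have : 0 ≤ pdx (sol.w 0) x s ^ 2 + pdx (sol.w 1) x s ^ 2 + pdx (sol.b 0) x s ^ 2
        + pdx (sol.b 1) x s ^ 2 := by positivity
      linarith)
    (fun t ht => (sol.bc_u t ht).1) (fun t ht => (sol.bc_u t ht).2)
    (fun t ht => (sol.bc_θ t ht).1) (fun t ht => (sol.bc_θ t ht).2) hρR hmb hMm hρθ
  have hN1 := dbl_mono (fun x t => pdx sol.u x t ^ 2) _
    (by unfold Function.uncurry; fun_prop) kD
    (fun x s => by
      have : 0 ≤ pdx (sol.w 0) x s ^ 2 + pdx (sol.w 1) x s ^ 2 + pdx (sol.b 0) x s ^ 2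
        + pdx (sol.b 1) x s ^ 2 := by positivity
      linarith) hdiss
  have hN2 : ∀ i : Fin 2, ∀ t ∈ Icc (0:ℝ) T,
      ∫ s in (0:ℝ)..t, ∫ x in (0:ℝ)..1, pdx (sol.w i) x s ^ 2 ≤ N := by
    intro i
    have kwi := (sm_pdx (sol.smooth_w i)).continuous
    apply dbl_mono (fun x t => pdx (sol.w i) x t ^ 2) _
      (by unfold Function.uncurry; fun_prop) kD _ hdiss
    intro x s
    fin_cases i
    · have : 0 ≤ pdx sol.u x s ^ 2 + pdx (sol.w 1) x s ^ 2 + pdx (sol.b 0) x s ^ 2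
        + pdx (sol.b 1) x s ^ 2 := by positivity
      simp only [Fin.zero_eta]
      linarith
    · have : 0 ≤ pdx sol.u x s ^ 2 + pdx (sol.w 0) x s ^ 2 + pdx (sol.b 0) x s ^ 2
        + pdx (sol.b 1) x s ^ 2 := by positivity
      simp only [Fin.mk_one]
      linarith
  have hYb : ∀ i : Fin 2, ∫ x in (0:ℝ)..1, pdx (sol.b i) x t ^ 2 ≤ Y := by
    intro i
    exact step_b (sol.b i) (pdx (sol.b i)) (pdx (pdx (sol.b i))) (pdt (sol.b i))
      (pdt (pdx (sol.b i))) sol.u (pdx sol.u) (pdx (sol.w i))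
      (sm_pdx (sol.smooth_b i)).continuous (sm_pdx (sm_pdx (sol.smooth_b i))).continuous
      (sm_pdt (sol.smooth_b i)).continuous (sm_pdt (sm_pdx (sol.smooth_b i))).continuous
      kux (sm_pdx (sol.smooth_w i)).continuous
      (sm_hx (sol.smooth_b i)) (sm_hx (sm_pdx (sol.smooth_b i)))
      (sm_ht (sm_pdx (sol.smooth_b i)))
      (fun x t => by
        rw [sm_symm (sol.smooth_b i)]
        exact sm_hx (sm_pdt (sol.smooth_b i)) x t)
      (sm_hx sol.smooth_u) (sol_b sol i)
      (fun t ht => (sol.bc_b i t ht).1) (fun t ht => (sol.bc_u t ht).1)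
      (sol_bt hT sol i 0 (fun t ht => (sol.bc_b i t ht).1))
      (sol_bt hT sol i 1 (fun t ht => (sol.bc_b i t ht).2))
      hN1 (hN2 i) (init_bd (sol.smooth_b i) (hI.2.2.2.2.1 i)).2.2 t ht
  have Y0 : 0 ≤ Y := le_trans (int_nonneg (fun x _ => sq_nonneg _)) (hYb 0)
  have slice : ∀ f : ℝ → ℝ → ℝ, ContDiff ℝ (⊤ : ℕ∞) (Function.uncurry f) →
      Continuous (fun x => f x t) := by
    intro f hf
    exact hf.continuous.comp (by fun_prop : Continuous fun x : ℝ => (x, t))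
  refine step_final hC₀ R0 Y0 (fun x => sol.ρ x t) (fun x => pdx sol.ρ x t)
    (fun x => sol.u x t) (fun x => pdx sol.u x t) (fun x => pdx (pdx sol.u) x t)
    (fun x => pdt sol.u x t) (fun x => sol.θ x t) (fun x => pdx sol.θ x t)
    (fun x => κ (sol.θ x t)) (fun x => sol.b 0 x t) (fun x => pdx (sol.b 0) x t)
    (fun x => sol.b 1 x t) (fun x => pdx (sol.b 1) x t)
    (slice _ sol.smooth_ρ) (slice _ (sm_pdx sol.smooth_ρ)) (slice _ (sm_pdx sol.smooth_u))
    (slice _ (sm_pdx (sm_pdx sol.smooth_u))) (slice _ (sm_pdt sol.smooth_u))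
    (slice _ (sm_pdx sol.smooth_θ)) ?_ (slice _ (sm_pdx (sol.smooth_b 0)))
    (slice _ (sm_pdx (sol.smooth_b 1)))
    (fun x => sm_hx sol.smooth_u x t) (fun x => sm_hx (sol.smooth_b 0) x t)
    (fun x => sm_hx (sol.smooth_b 1) x t) (sol.bc_u t ht).1 (sol.bc_b 0 t ht).1
    (sol.bc_b 1 t ht).1 (fun x hx => sol_mom sol x hx t ht)
    (fun x hx => sol.ρ_pos x hx t ht) (fun x hx => sol.θ_pos x hx t ht)
    (fun x hx => hρR x hx t ht) ?_ ?_ (hYb 0) (hYb 1)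
  · exact (sol_kc hκ sol).comp (f := fun x => (x, t)) (by fun_prop) (fun x hx => ⟨hx, ht⟩)
  · intro x hx
    exact le_csSup (isCompact_Icc.image (slice _ sol.smooth_θ)).bddAbove ⟨x, hx, rfl⟩
  · intro x hx
    have hp := sol.θ_pos x hx t ht
    refine le_trans ?_ (hκ.2.1 _ hp.le)
    have hq0 : 0 < sol.θ x t ^ q := Real.rpow_pos_of_pos hp _
    have : 0 < C₀⁻¹ := by positivity
    nlinarith
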